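/- arXiv:2507.15153 — 3 statements merged into one kernel-verified Lean document; each statement's English description precedes it below -/
import Mathlib

section
/- For any real number L with 1/2 ≤ L ≤ 1 and any ε > 0, there exists a finite group G such that |θ(G) − L| < ε. -/
open scoped Classical

noncomputable section

/-- `z` is a (complex) root of unity. -/
def IsRootOfUnity (z : ℂ) : Prop := ∃ n : ℕ, 0 < n ∧ z ^ n = 1

/-- `χ` is an irreducible complex character of the group `G`, i.e. the character of some
simple (irreducible) finite-dimensional complex representation of `G`. -/
def IsIrredChar {G : Type} [Group G] (χ : G → ℂ) : Prop :=
  ∃ V : FDRep ℂ G, CategoryTheory.Simple V ∧ χ = V.character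

/-- `z_I(G)`: the proportion of pairs `(χ, g) ∈ Irr(G) × G` with `χ g = 0`. -/
def zIG (G : Type) [Group G] : ℝ :=
  (Nat.card {p : (G → ℂ) × G | IsIrredChar p.1 ∧ p.1 p.2 = 0} : ℝ) /
    ((Nat.card {χ : G → ℂ | IsIrredChar χ} : ℝ) * (Nat.card G : ℝ))

/-- `u_I(G)`: the proportion of pairs `(χ, g) ∈ Irr(G) × G` with `χ g` a root of unity. -/
def uIG (G : Type) [Group G] : ℝ :=
  (Nat.card {p : (G → ℂ) × G | IsIrredChar p.1 ∧ IsRootOfUnity (p.1 p.2)} : ℝ) /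
    ((Nat.card {χ : G → ℂ | IsIrredChar χ} : ℝ) * (Nat.card G : ℝ))

/-- `θ(G)`: the proportion of pairs `(χ, g) ∈ Irr(G) × G` with `χ g` zero or a root of
unity. -/
def thetaG (G : Type) [Group G] : ℝ :=
  (Nat.card {p : (G → ℂ) × G |
      IsIrredChar p.1 ∧ (p.1 p.2 = 0 ∨ IsRootOfUnity (p.1 p.2))} : ℝ) /
    ((Nat.card {χ : G → ℂ | IsIrredChar χ} : ℝ) * (Nat.card G : ℝ))

/-- `z_II(G)`: the proportion of pairs `(χ, C) ∈ Irr(G) × Cl(G)` such that `χ` vanishes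
on the conjugacy class `C`. -/
def zIIG (G : Type) [Group G] : ℝ :=
  (Nat.card {p : (G → ℂ) × ConjClasses G |
      IsIrredChar p.1 ∧ ∀ g ∈ p.2.carrier, p.1 g = 0} : ℝ) /
    ((Nat.card {χ : G → ℂ | IsIrredChar χ} : ℝ) * (Nat.card (ConjClasses G) : ℝ))

/-- `u_II(G)`: the proportion of pairs `(χ, gᴳ) ∈ Irr(G) × Cl(G)` with `χ g` a root of
unity. -/
def uIIG (G : Type) [Group G] : ℝ :=
  (Nat.card {p : (G → ℂ) × ConjClasses G |
      IsIrredChar p.1 ∧ ∃ g, ConjClasses.mk g = p.2 ∧ IsRootOfUnity (p.1 g)} : ℝ) /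
    ((Nat.card {χ : G → ℂ | IsIrredChar χ} : ℝ) * (Nat.card (ConjClasses G) : ℝ))

/-- `θ_II(G)`: the proportion of pairs `(χ, gᴳ) ∈ Irr(G) × Cl(G)` with `χ g` zero or a
root of unity. -/
def thetaIIG (G : Type) [Group G] : ℝ :=
  (Nat.card {p : (G → ℂ) × ConjClasses G |
      IsIrredChar p.1 ∧ ∃ g, ConjClasses.mk g = p.2 ∧
        (p.1 g = 0 ∨ IsRootOfUnity (p.1 g))} : ℝ) /
    ((Nat.card {χ : G → ℂ | IsIrredChar χ} : ℝ) * (Nat.card (ConjClasses G) : ℝ))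

/-- The proportion of pairs `(i, g)` for which `χ i g` has the property `P`. -/
def valueProportion {ι G : Type} (χ : ι → G → ℂ) (P : ℂ → Prop) : ℝ :=
  (Nat.card {p : ι × G | P (χ p.1 p.2)} : ℝ) / (Nat.card ι * Nat.card G)

theorem valueProportion_nonneg {ι G : Type} (χ : ι → G → ℂ) (P : ℂ → Prop) :
    0 ≤ valueProportion χ P :=
  div_nonneg (Nat.cast_nonneg _) (by positivity)

/-- The family `χ` consists of characters, is orthonormal, and decomposes the character of the
regular representation: it is the full list of irreducible characters of `G`. -/
structure IsCharacterTable {G ι : Type} [Group G] [Fintype G] [Fintype ι]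
    (χ : ι → G → ℂ) : Prop where
  exists_rep : ∀ i, ∃ V : FDRep ℂ G, χ i = V.character
  orthogonal : ∀ i j, ∑ g, χ i g * χ j g⁻¹ = if i = j then (Nat.card G : ℂ) else 0
  regular : ∀ g, ∑ i, χ i 1 * χ i g = if g = 1 then (Nat.card G : ℂ) else 0

namespace IsCharacterTable

section

variable {G ι : Type} [Group G] [Fintype G] [Fintype ι] {χ : ι → G → ℂ}

theorem injective (h : IsCharacterTable χ) : Function.Injective χ := by
  intro i j hij
  by_contra hne
  have h1 := h.orthogonal i i
  have h2 := h.orthogonal i j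
  rw [if_pos rfl] at h1
  rw [if_neg hne, ← hij, h1] at h2
  exact Nat.cast_ne_zero.2 Nat.card_pos.ne' h2

theorem isIrredChar (h : IsCharacterTable χ) (i : ι) : IsIrredChar (χ i) := by
  obtain ⟨V, hV⟩ := h.exists_rep i
  refine ⟨V, (FDRep.simple_iff_char_is_norm_one V).2 ?_, hV⟩
  simpa [← hV] using h.orthogonal i i

theorem exists_eq (h : IsCharacterTable χ) {f : G → ℂ} (hf : IsIrredChar f) :
    ∃ i, χ i = f := by
  obtain ⟨W, hW, rfl⟩ := hf
  by_contra! hne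
  have hG : (Nat.card G : ℂ) ≠ 0 := Nat.cast_ne_zero.2 Nat.card_pos.ne'
  have := invertibleOfNonzero hG
  have horth : ∀ i, ∑ g, χ i g * W.character g⁻¹ = 0 := by
    intro i
    obtain ⟨V, hV, hVi⟩ := h.isIrredChar i
    have := FDRep.char_orthonormal V W
    rw [if_neg] at this
    · rw [hVi]
      exact (mul_eq_zero.1 this).resolve_left (inv_ne_zero hG)
    · rintro ⟨e⟩
      exact hne i (hVi.trans (FDRep.char_iso e))
  have hsum : ∑ i, χ i 1 * ∑ g, χ i g * W.character g⁻¹ = Nat.card G * W.character 1 := by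
    simp_rw [Finset.mul_sum, ← mul_assoc]
    rw [Finset.sum_comm]
    simp_rw [← Finset.sum_mul, h.regular]
    simp
  have hone : W.character 1 = 0 := by
    simp only [horth, mul_zero, Finset.sum_const_zero] at hsum
    exact (mul_eq_zero.1 hsum.symm).resolve_left hG
  have hself := (FDRep.simple_iff_char_is_norm_one W).1 hW
  have hrank : Module.finrank ℂ W = 0 := by
    rw [FDRep.char_one] at hone
    exact_mod_cast hone
  have hzero : ∀ g, W.character g = 0 := by
    intro g
    have := Module.finrank_zero_iff.1 hrank
    change LinearMap.trace ℂ W (W.ρ g) = 0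
    rw [Subsingleton.elim (W.ρ g) 0, map_zero]
  simp only [hzero, mul_zero, Finset.sum_const_zero] at hself
  exact hG hself.symm

/-- `θ(G)` counted on a character table. -/
theorem thetaG_eq (h : IsCharacterTable χ) :
    thetaG G = valueProportion χ (fun z ↦ z = 0 ∨ IsRootOfUnity z) := by
  have h1 : Nat.card {f : G → ℂ | IsIrredChar f} = Nat.card ι := by
    refine (Nat.card_congr (Equiv.ofBijective (fun i ↦ ⟨χ i, h.isIrredChar i⟩) ⟨?_, ?_⟩)).symm
    · exact fun i j hij ↦ h.injective (congrArg Subtype.val hij)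
    · rintro ⟨f, hf⟩
      obtain ⟨i, hi⟩ := h.exists_eq hf
      exact ⟨i, Subtype.ext hi⟩
  have h2 : Nat.card {p : (G → ℂ) × G |
      IsIrredChar p.1 ∧ (p.1 p.2 = 0 ∨ IsRootOfUnity (p.1 p.2))} =
      Nat.card {p : ι × G | χ p.1 p.2 = 0 ∨ IsRootOfUnity (χ p.1 p.2)} := by
    refine (Nat.card_congr (Equiv.ofBijective
      (fun p ↦ ⟨(χ p.1.1, p.1.2), h.isIrredChar _, p.2⟩) ⟨?_, ?_⟩)).symm
    · rintro ⟨⟨i, g⟩, hp⟩ ⟨⟨j, k⟩, hq⟩ hpq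
      simp only [Subtype.mk.injEq, Prod.mk.injEq] at hpq
      simp [h.injective hpq.1, hpq.2]
    · rintro ⟨⟨f, g⟩, hf, hp⟩
      obtain ⟨i, rfl⟩ := h.exists_eq hf
      exact ⟨⟨(i, g), hp⟩, rfl⟩
  rw [thetaG, valueProportion, h1, h2]

end

/-- The character table of a direct product. -/
theorem prod {G H ι κ : Type} [Group G] [Fintype G] [Fintype ι] [Group H] [Fintype H] [Fintype κ]
    {χ : ι → G → ℂ} {η : κ → H → ℂ} (hχ : IsCharacterTable χ) (hη : IsCharacterTable η) :
    IsCharacterTable fun (p : ι × κ) (g : G × H) ↦ χ p.1 g.1 * η p.2 g.2 where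
  exists_rep := by
    rintro ⟨i, j⟩
    obtain ⟨V, hV⟩ := hχ.exists_rep i
    obtain ⟨W, hW⟩ := hη.exists_rep j
    refine ⟨FDRep.of (Representation.tprod (V.ρ.comp (MonoidHom.fst G H))
      (W.ρ.comp (MonoidHom.snd G H))), ?_⟩
    funext g
    rw [hV, hW]
    exact (congrFun (Representation.char_tensor (V.ρ.comp (MonoidHom.fst G H))
      (W.ρ.comp (MonoidHom.snd G H))) g).symm
  orthogonal := by
    rintro ⟨i, j⟩ ⟨i', j'⟩
    have := congrArg₂ (· * ·) (hχ.orthogonal i i') (hη.orthogonal j j')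
    simp only [Finset.sum_mul_sum, ← Finset.sum_product', Finset.univ_product_univ] at this
    simp only [Prod.fst_inv, Prod.snd_inv, Prod.mk.injEq, Nat.card_prod, Nat.cast_mul]
    refine Eq.trans (Finset.sum_congr rfl fun g _ ↦ by ring) (this.trans ?_)
    split_ifs <;> simp_all
  regular := by
    rintro ⟨g, h⟩
    have := congrArg₂ (· * ·) (hχ.regular g) (hη.regular h)
    simp only [Finset.sum_mul_sum, ← Finset.sum_product', Finset.univ_product_univ] at this
    simp only [Prod.fst_one, Prod.snd_one, Prod.mk_eq_one, Nat.card_prod, Nat.cast_mul]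
    refine Eq.trans (Finset.sum_congr rfl fun g _ ↦ by ring) (this.trans ?_)
    split_ifs <;> simp_all

end IsCharacterTable

/-- The group of affine maps `t ↦ b * t + a` of the field `F` with `b` in the subgroup `B` of
`Fˣ`. -/
@[ext]
structure AffineMaps {F : Type} [Field F] (B : Subgroup Fˣ) where
  /-- The translation part. -/
  shift : F
  /-- The linear part. -/
  scale : B

namespace AffineMaps

variable {F : Type} [Field F] {B : Subgroup Fˣ}

instance : Mul (AffineMaps B) where
  mul g h := ⟨g.shift + (g.scale : Fˣ) * h.shift, g.scale * h.scale⟩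

instance : One (AffineMaps B) where
  one := ⟨0, 1⟩

instance : Inv (AffineMaps B) where
  inv g := ⟨-(((g.scale⁻¹ : B) : Fˣ) * g.shift), g.scale⁻¹⟩

@[simp] theorem mul_shift (g h : AffineMaps B) :
    (g * h).shift = g.shift + (g.scale : Fˣ) * h.shift := rfl

@[simp] theorem mul_scale (g h : AffineMaps B) : (g * h).scale = g.scale * h.scale := rfl

@[simp] theorem one_shift : (1 : AffineMaps B).shift = 0 := rfl

@[simp] theorem one_scale : (1 : AffineMaps B).scale = 1 := rfl

@[simp] theorem inv_shift (g : AffineMaps B) :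
    g⁻¹.shift = -(((g.scale⁻¹ : B) : Fˣ) * g.shift) := rfl

@[simp] theorem inv_scale (g : AffineMaps B) : g⁻¹.scale = g.scale⁻¹ := rfl

instance : Group (AffineMaps B) :=
  Group.ofLeftAxioms
    (fun g h k ↦ by ext <;> simp [mul_assoc, mul_add, add_assoc])
    (fun g ↦ by ext <;> simp)
    (fun g ↦ by ext <;> simp)

/-- An affine map is determined by its translation part and its linear part. -/
@[simps]
def equivProd : AffineMaps B ≃ F × B where
  toFun g := (g.shift, g.scale)
  invFun p := ⟨p.1, p.2⟩
  left_inv _ := rfl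
  right_inv _ := rfl

instance [Fintype F] : Fintype (AffineMaps B) := Fintype.ofEquiv _ equivProd.symm

theorem card_eq : Nat.card (AffineMaps B) = Nat.card F * Nat.card B := by
  rw [Nat.card_congr equivProd, Nat.card_prod]

theorem sum_eq [Fintype F] {M : Type} [AddCommMonoid M] (f : AffineMaps B → M) :
    ∑ g, f g = ∑ b : B, ∑ a : F, f ⟨a, b⟩ := by
  rw [← equivProd.symm.sum_comp, Fintype.sum_prod_type_right]
  rfl

/-- The representation of the group of affine maps on functions on `B` induced from the character
`a ↦ ψ (a * c)` of the group of translations. -/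
def inducedRep (ψ : AddChar F ℂ) (c : F) : Representation ℂ (AffineMaps B) (B → ℂ) where
  toFun g :=
    { toFun := fun f x ↦ ψ (g.shift * (c * (x : Fˣ))) * f (x * g.scale)
      map_add' := fun f f' ↦ by ext x; simp [mul_add]
      map_smul' := fun r f ↦ by ext x; simp [mul_left_comm] }
  map_one' := by ext f x; simp
  map_mul' g h := by
    refine LinearMap.ext fun f ↦ funext fun x ↦ ?_
    simp only [mul_shift, mul_scale, LinearMap.coe_mk, AddHom.coe_mk, Module.End.mul_apply,
      ← mul_assoc, ← AddChar.map_add_eq_mul]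
    congr 2
    push_cast
    ring

theorem inducedRep_character [Fintype F] (ψ : AddChar F ℂ) (c : F) (g : AffineMaps B) :
    (inducedRep ψ c).character g =
      if g.scale = 1 then ∑ x : B, ψ (g.shift * (c * (x : Fˣ))) else 0 := by
  rw [Representation.character, LinearMap.trace_eq_matrix_trace ℂ (Pi.basisFun ℂ B),
    Matrix.trace]
  simp only [Matrix.diag_apply, LinearMap.toMatrix_apply, Pi.basisFun_apply, Pi.basisFun_repr,
    inducedRep, MonoidHom.coe_mk, OneHom.coe_mk, LinearMap.coe_mk, AddHom.coe_mk]
  simp only [Pi.single_apply, mul_eq_left]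
  split_ifs <;> simp

/-- The irreducible characters of the group of affine maps, with respect to a nontrivial additive
character `ψ` of the field. -/
def irredChar [Fintype F] (B : Subgroup Fˣ) (ψ : AddChar F ℂ) :
    AddChar (Additive B) ℂ ⊕ (Fˣ ⧸ B) → AffineMaps B → ℂ
  | Sum.inl β, g => β (Additive.ofMul g.scale)
  | Sum.inr c, g => if g.scale = 1 then ∑ x : B, ψ (g.shift * ((c.out : F) * (x : Fˣ))) else 0

theorem irredChar_inl [Fintype F] (ψ : AddChar F ℂ) (β : AddChar (Additive B) ℂ)
    (g : AffineMaps B) : irredChar B ψ (Sum.inl β) g = β (Additive.ofMul g.scale) := rfl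

theorem irredChar_inr [Fintype F] (ψ : AddChar F ℂ) (c : Fˣ ⧸ B) (g : AffineMaps B) :
    irredChar B ψ (Sum.inr c) g =
      if g.scale = 1 then ∑ x : B, ψ (g.shift * ((c.out : F) * (x : Fˣ))) else 0 := rfl

theorem out_mul_eq_iff (c d : Fˣ ⧸ B) (x y : B) :
    (c.out : F) * (x : Fˣ) = (d.out : F) * (y : Fˣ) ↔ c = d ∧ x = y := by
  refine ⟨fun h ↦ ?_, by rintro ⟨rfl, rfl⟩; rfl⟩
  have h' : c.out * (x : Fˣ) = d.out * (y : Fˣ) := Units.ext (by simpa using h)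
  have hcd : c = d := by
    rw [← QuotientGroup.out_eq' c, ← QuotientGroup.out_eq' d,
      ← QuotientGroup.mk_mul_of_mem c.out x.2, h', QuotientGroup.mk_mul_of_mem _ y.2]
  subst hcd
  exact ⟨rfl, Subtype.ext (mul_left_cancel h')⟩

theorem bijective_out_mul :
    Function.Bijective fun p : (Fˣ ⧸ B) × B ↦ p.1.out * (p.2 : Fˣ) := by
  constructor
  · rintro ⟨c, x⟩ ⟨d, y⟩ h
    have := (out_mul_eq_iff c d x y).1 (by exact_mod_cast congrArg Units.val h)
    exact Prod.ext this.1 this.2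
  · intro u
    have : (QuotientGroup.mk u : Fˣ ⧸ B).out⁻¹ * u ∈ B := by
      rw [← QuotientGroup.eq, QuotientGroup.out_eq']
    exact ⟨(QuotientGroup.mk u, ⟨_, this⟩), by simp⟩

theorem sum_mul_eq_zero [Fintype F] {ψ : AddChar F ℂ} (hψ : ψ.IsPrimitive) (c : Fˣ) (x : B) :
    ∑ a : F, ψ (a * ((c : F) * (x : Fˣ))) = 0 := by
  rw [AddChar.sum_mulShift _ hψ]
  simp

theorem isCharacterTable_irredChar [Fintype F] {ψ : AddChar F ℂ} (hψ : ψ.IsPrimitive) :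
    IsCharacterTable (irredChar B ψ) where
  exists_rep := by
    rintro (β | c)
    · let ρ : Representation ℂ (AffineMaps B) ℂ :=
        { toFun := fun g ↦ β (Additive.ofMul g.scale) • 1
          map_one' := by simp
          map_mul' := fun g h ↦ by
            ext
            simp [AddChar.map_add_eq_mul, mul_comm] }
      refine ⟨FDRep.of ρ, funext fun g ↦ ?_⟩
      change _ = LinearMap.trace ℂ ℂ (ρ g)
      simp [ρ, irredChar_inl]
    · refine ⟨FDRep.of (inducedRep ψ c.out), funext fun g ↦ ?_⟩
      exact (inducedRep_character ψ _ g).symm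
  orthogonal := by
    rintro (β | c) (γ | d)
    · simp only [sum_eq, irredChar_inl, inv_scale, ofMul_inv, ← AddChar.sub_apply,
        Finset.sum_const, ← Finset.smul_sum]
      have := AddChar.sum_eq_ite (β - γ)
      rw [← Additive.ofMul.sum_comp] at this
      rw [this, card_eq]
      simp [sub_eq_zero]
    · simp only [sum_eq, irredChar_inl, irredChar_inr, inv_scale, inv_eq_one, mul_ite, mul_zero,
        inv_shift]
      rw [Finset.sum_eq_single 1 (by simp +contextual) (by simp)]
      simp only [if_true, ofMul_one, AddChar.map_zero_eq_one, one_mul, inv_one, OneMemClass.coe_one,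
        Units.val_one]
      rw [Finset.sum_comm]
      refine (Finset.sum_eq_zero fun x _ ↦ ?_).trans (by simp)
      simpa using AddChar.sum_mulShift (-((d.out : F) * (x : Fˣ))) hψ
    · simp only [sum_eq, irredChar_inl, irredChar_inr, inv_scale, ite_mul, zero_mul]
      rw [Finset.sum_eq_single 1 (by simp +contextual) (by simp)]
      simp only [if_true, ← Finset.sum_mul]
      rw [Finset.sum_comm]
      simp [sum_mul_eq_zero hψ]
    · simp only [sum_eq, irredChar_inr, inv_scale, inv_eq_one, mul_ite, ite_mul, mul_zero, zero_mul,
        inv_shift]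
      rw [Finset.sum_eq_single 1 (by simp +contextual) (by simp)]
      simp only [if_true, Finset.sum_mul_sum, ← AddChar.map_add_eq_mul]
      rw [Finset.sum_comm]
      have key : ∀ x y : B, ∑ a : F, ψ (a * ((c.out : F) * (x : Fˣ)) +
          -((((1 : B)⁻¹ : B) : Fˣ) * a) * ((d.out : F) * (y : Fˣ))) =
          if c = d ∧ x = y then (Nat.card F : ℂ) else 0 := by
        intro x y
        have := AddChar.sum_mulShift ((c.out : F) * (x : Fˣ) - (d.out : F) * (y : Fˣ)) hψ
        simp only [sub_eq_zero, out_mul_eq_iff] at this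
        refine Eq.trans (Finset.sum_congr rfl fun a _ ↦ ?_) (this.trans ?_)
        · congr 1
          simp
          ring
        · simp
      simp_rw [Finset.sum_comm (s := (Finset.univ : Finset F)), key]
      by_cases hcd : c = d
      · simp [-Nat.card_eq_fintype_card, hcd, card_eq]
        rw [Nat.card_eq_fintype_card (α := B), mul_comm]
      · simp [hcd]
  regular := by
    rintro ⟨a, b⟩
    simp only [Fintype.sum_sum_type, irredChar_inl, irredChar_inr, one_scale, one_shift, if_true,
      ofMul_one, AddChar.map_zero_eq_one, one_mul, zero_mul, Finset.sum_const]
    rw [AddChar.sum_apply_eq_ite, card_eq]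
    by_cases hb : b = 1
    · subst hb
      have h1 : ∑ c : Fˣ ⧸ B, ∑ x : B, ψ (a * ((c.out : F) * (x : Fˣ))) =
          ∑ u : Fˣ, ψ (a * u) := by
        rw [← Fintype.sum_prod_type']
        exact Fintype.sum_bijective _ bijective_out_mul _ _ fun p ↦ by simp
      have h2 : ∑ u : Fˣ, ψ (a * u) = (if a = 0 then (Nat.card F : ℂ) else 0) - 1 := by
        have h := AddChar.sum_mulShift a hψ
        rw [Fintype.sum_eq_add_sum_subtype_ne _ 0, ← unitsEquivNeZero.sum_comp] at h
        rw [eq_sub_iff_add_eq']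
        simpa [mul_comm] using h
      have h3 : (⟨a, 1⟩ : AffineMaps B) = 1 ↔ a = 0 :=
        ⟨congrArg shift, fun h ↦ AffineMaps.ext h rfl⟩
      simp only [if_true, ofMul_one, ← Finset.mul_sum, h1, h2, h3]
      rw [Fintype.card_congr Additive.toMul]
      split_ifs <;> simp
      ring
    · have : (⟨a, b⟩ : AffineMaps B) ≠ 1 := fun h ↦ hb (congrArg scale h)
      simp [hb, this]

end AffineMaps

theorem valueProportion_not {ι G : Type} [Finite ι] [Finite G] [Nonempty ι] [Nonempty G]
    (χ : ι → G → ℂ) (P : ℂ → Prop) :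
    valueProportion χ (fun z ↦ ¬ P z) = 1 - valueProportion χ P := by
  have h := Set.ncard_add_ncard_compl {p : ι × G | P (χ p.1 p.2)}
  rw [Nat.card_prod] at h
  have h' : (Nat.card {p : ι × G | P (χ p.1 p.2)} : ℝ) +
      Nat.card {p : ι × G | ¬ P (χ p.1 p.2)} = Nat.card ι * Nat.card G := by
    exact_mod_cast h
  have hι : (Nat.card ι : ℝ) ≠ 0 := Nat.cast_ne_zero.2 Nat.card_pos.ne'
  have hG : (Nat.card G : ℝ) ≠ 0 := Nat.cast_ne_zero.2 Nat.card_pos.ne'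
  unfold valueProportion
  rw [eq_sub_iff_add_eq, ← add_div, add_comm, h', div_self (mul_ne_zero hι hG)]

section prod

variable {ι G κ H : Type} (χ : ι → G → ℂ) (η : κ → H → ℂ) {P Q R : ℂ → Prop}

theorem valueProportion_mul (P Q : ℂ → Prop) :
    valueProportion χ P * valueProportion η Q =
      (Nat.card {p : (ι × κ) × (G × H) | P (χ p.1.1 p.2.1) ∧ Q (η p.1.2 p.2.2)} : ℝ) /
        (Nat.card (ι × κ) * Nat.card (G × H)) := by
  have : Nat.card {p : (ι × κ) × (G × H) | P (χ p.1.1 p.2.1) ∧ Q (η p.1.2 p.2.2)} =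
      Nat.card {p : ι × G | P (χ p.1 p.2)} * Nat.card {p : κ × H | Q (η p.1 p.2)} := by
    rw [← Nat.card_prod]
    exact Nat.card_congr
      ⟨fun p ↦ (⟨(p.1.1.1, p.1.2.1), p.2.1⟩, ⟨(p.1.1.2, p.1.2.2), p.2.2⟩),
        fun p ↦ ⟨((p.1.1.1, p.2.1.1), (p.1.1.2, p.2.1.2)), p.1.2, p.2.2⟩,
        fun _ ↦ rfl, fun _ ↦ rfl⟩
  rw [valueProportion, valueProportion, this, div_mul_div_comm, Nat.card_prod, Nat.card_prod]
  push_cast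
  ring

theorem valueProportion_mul_le [Finite ι] [Finite G] [Finite κ] [Finite H]
    (h : ∀ z w, P z → Q w → R (z * w)) :
    valueProportion χ P * valueProportion η Q ≤
      valueProportion (fun (p : ι × κ) (g : G × H) ↦ χ p.1 g.1 * η p.2 g.2) R := by
  rw [valueProportion_mul, valueProportion]
  gcongr
  exact Nat.card_mono (Set.toFinite _) fun p hp ↦ h _ _ hp.1 hp.2

theorem valueProportion_le_mul [Finite ι] [Finite G] [Finite κ] [Finite H]
    (h : ∀ z w, R (z * w) → P z ∧ Q w) :
    valueProportion (fun (p : ι × κ) (g : G × H) ↦ χ p.1 g.1 * η p.2 g.2) R ≤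
      valueProportion χ P * valueProportion η Q := by
  rw [valueProportion_mul, valueProportion]
  gcongr
  exact Nat.card_mono (Set.toFinite _) fun p hp ↦ h _ _ hp

end prod

theorem IsRootOfUnity.ne_zero {z : ℂ} (hz : IsRootOfUnity z) : z ≠ 0 := by
  obtain ⟨n, hn, h⟩ := hz
  rintro rfl
  simp [hn.ne'] at h

theorem IsRootOfUnity.of_mul_right {z w : ℂ} (hzw : IsRootOfUnity (z * w))
    (hw : IsRootOfUnity w) : IsRootOfUnity z := by
  obtain ⟨n, hn, h⟩ := hzw
  obtain ⟨m, hm, h'⟩ := hw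
  refine ⟨n * m, Nat.mul_pos hn hm, ?_⟩
  calc z ^ (n * m) = z ^ (n * m) * (w ^ m) ^ n := by rw [h', one_pow, mul_one]
    _ = ((z * w) ^ n) ^ m := by ring
    _ = 1 := by rw [h, one_pow]

/-- Bounds for `1 - θ` of a direct product. -/
theorem one_sub_thetaG_prod_bounds {G H ι κ : Type} [Group G] [Fintype G] [Fintype ι]
    [Group H] [Fintype H] [Fintype κ] [Nonempty ι] [Nonempty κ] {χ : ι → G → ℂ} {η : κ → H → ℂ}
    (hχ : IsCharacterTable χ) (hη : IsCharacterTable η) :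
    valueProportion χ (fun z ↦ ¬ (z = 0 ∨ IsRootOfUnity z)) * valueProportion η IsRootOfUnity ≤
        1 - thetaG (G × H) ∧
      1 - thetaG (G × H) ≤ valueProportion χ (· ≠ 0) * valueProportion η (· ≠ 0) := by
  have h := (hχ.prod hη).thetaG_eq
  rw [h, ← valueProportion_not]
  constructor
  · refine valueProportion_mul_le χ η fun z w hz hw hzw ↦ hz ?_
    refine hzw.imp (fun h ↦ ?_) (fun h ↦ h.of_mul_right hw)
    exact (mul_eq_zero.1 h).resolve_right hw.ne_zero
  · refine valueProportion_le_mul χ η fun z w hzw ↦ ?_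
    exact mul_ne_zero_iff.1 fun h ↦ hzw (Or.inl h)

namespace AffineMaps

variable {F : Type} [Field F] [Fintype F] {B : Subgroup Fˣ} (ψ : AddChar F ℂ)

theorem card_index : Nat.card (AddChar (Additive B) ℂ ⊕ (Fˣ ⧸ B)) = Nat.card B + B.index := by
  rw [Nat.card_sum, Subgroup.index, Nat.card_eq_fintype_card (α := AddChar _ _), AddChar.card_eq,
    ← Nat.card_eq_fintype_card]
  rfl

theorem le_valueProportion_isRootOfUnity :
    (Nat.card B : ℝ) / (Nat.card B + B.index) ≤
      valueProportion (irredChar B ψ) IsRootOfUnity := by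
  have hG : (0 : ℝ) < Nat.card (AffineMaps B) := Nat.cast_pos.2 Nat.card_pos
  have hB : (0 : ℝ) < Nat.card B := Nat.cast_pos.2 Nat.card_pos
  have hle : Nat.card (AddChar (Additive B) ℂ × AffineMaps B) ≤
      Nat.card {p : (AddChar (Additive B) ℂ ⊕ (Fˣ ⧸ B)) × AffineMaps B |
        IsRootOfUnity (irredChar B ψ p.1 p.2)} := by
    refine Nat.card_le_card_of_injective (fun p ↦ ⟨(Sum.inl p.1, p.2), Nat.card B, Nat.card_pos, ?_⟩)
      ?_
    · rw [irredChar_inl, ← AddChar.map_nsmul_eq_pow, ← ofMul_pow, pow_card_eq_one']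
      simp
    · rintro ⟨β, g⟩ ⟨γ, k⟩ h
      have h' := congrArg Subtype.val h
      simpa using h'
  rw [Nat.card_prod, Nat.card_eq_fintype_card (α := AddChar _ _), AddChar.card_eq,
    ← Nat.card_eq_fintype_card] at hle
  have hle' : (Nat.card B : ℝ) * Nat.card (AffineMaps B) ≤
      Nat.card {p : (AddChar (Additive B) ℂ ⊕ (Fˣ ⧸ B)) × AffineMaps B |
        IsRootOfUnity (irredChar B ψ p.1 p.2)} := by
    exact_mod_cast hle
  rw [valueProportion, card_index, ← mul_div_mul_right _ _ hG.ne']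
  push_cast
  gcongr

theorem valueProportion_ne_zero_le :
    valueProportion (irredChar B ψ) (· ≠ 0) ≤
      (Nat.card B : ℝ) / (Nat.card B + B.index) +
        (B.index : ℝ) / (Nat.card B + B.index) / Nat.card B := by
  have hF : (0 : ℝ) < Nat.card F := Nat.cast_pos.2 Nat.card_pos
  have hB : (0 : ℝ) < Nat.card B := Nat.cast_pos.2 Nat.card_pos
  have hle : Nat.card {p : (AddChar (Additive B) ℂ ⊕ (Fˣ ⧸ B)) × AffineMaps B |
        irredChar B ψ p.1 p.2 ≠ 0} ≤
      Nat.card ((AddChar (Additive B) ℂ × AffineMaps B) ⊕ ((Fˣ ⧸ B) × F)) := by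
    let f : (AddChar (Additive B) ℂ × AffineMaps B) ⊕ ((Fˣ ⧸ B) × F) →
        (AddChar (Additive B) ℂ ⊕ (Fˣ ⧸ B)) × AffineMaps B :=
      Sum.elim (fun p ↦ (Sum.inl p.1, p.2)) (fun p ↦ (Sum.inr p.1, ⟨p.2, 1⟩))
    have hsub : {p : (AddChar (Additive B) ℂ ⊕ (Fˣ ⧸ B)) × AffineMaps B |
        irredChar B ψ p.1 p.2 ≠ 0} ⊆ Set.range f := by
      rintro ⟨β | c, g⟩ hp
      · exact ⟨Sum.inl (β, g), rfl⟩
      · have hg : g.scale = 1 := by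
          by_contra hg
          exact hp (if_neg hg)
        exact ⟨Sum.inr (c, g.shift), Prod.ext rfl (AffineMaps.ext rfl hg.symm)⟩
    exact (Nat.card_mono (Set.toFinite _) hsub).trans (Finite.card_range_le f)
  rw [Nat.card_sum, Nat.card_prod, Nat.card_prod, Nat.card_eq_fintype_card (α := AddChar _ _),
    AddChar.card_eq, ← Nat.card_eq_fintype_card, card_eq] at hle
  have hle' : (Nat.card {p : (AddChar (Additive B) ℂ ⊕ (Fˣ ⧸ B)) × AffineMaps B |
        irredChar B ψ p.1 p.2 ≠ 0} : ℝ) ≤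
      Nat.card B * (Nat.card F * Nat.card B) + B.index * Nat.card F := by
    exact_mod_cast hle
  rw [valueProportion, card_index, card_eq]
  push_cast
  refine (div_le_div_of_nonneg_right hle' (by positivity)).trans_eq ?_
  field_simp

end AffineMaps

theorem add_inv_not_isRootOfUnity {ζ : ℂ} {p : ℕ} (hp : p.Coprime 12) (h : ζ ^ p = 1)
    (h1 : ζ ≠ 1) : ¬ (ζ + ζ⁻¹ = 0 ∨ IsRootOfUnity (ζ + ζ⁻¹)) := by
  have hp0 : p ≠ 0 := by
    rintro rfl
    simp at hp
  have h0 : ζ ≠ 0 := by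
    rintro rfl
    simp [hp0] at h
  have h12 : ζ ^ 12 ≠ 1 := by
    intro h12
    have := Nat.dvd_gcd (orderOf_dvd_of_pow_eq_one h) (orderOf_dvd_of_pow_eq_one h12)
    rw [hp.gcd_eq_one, Nat.dvd_one, orderOf_eq_one_iff] at this
    exact h1 this
  rintro (hz | ⟨n, hn, hz⟩)
  · have h2 : ζ ^ 2 = -1 := by
      field_simp at hz
      linear_combination hz
    exact h12 (by rw [show 12 = 2 * 6 by rfl, pow_mul, h2]; norm_num)
  · have hinv : ζ⁻¹ = (starRingEnd ℂ) ζ :=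
      Complex.inv_eq_conj (Complex.norm_eq_one_of_pow_eq_one h hp0)
    have hreal : ((2 * ζ.re : ℝ) : ℂ) = ζ + ζ⁻¹ := by
      rw [hinv, Complex.add_conj]
    have hnorm := Complex.norm_eq_one_of_pow_eq_one hz hn.ne'
    rw [← hreal, Complex.norm_real, Real.norm_eq_abs, abs_eq zero_le_one] at hnorm
    rcases hnorm with hr | hr
    · rw [hr] at hreal
      have h2 : ζ ^ 2 = ζ - 1 := by
        field_simp at hreal
        push_cast at hreal
        linear_combination -hreal
      have h3 : ζ ^ 3 = -1 := by linear_combination (ζ + 1) * h2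
      exact h12 (by rw [show 12 = 3 * 4 by rfl, pow_mul, h3]; norm_num)
    · rw [hr] at hreal
      have h2 : ζ ^ 2 = -ζ - 1 := by
        field_simp at hreal
        push_cast at hreal
        linear_combination -hreal
      have h3 : ζ ^ 3 = 1 := by linear_combination (ζ - 1) * h2
      exact h12 (by rw [show 12 = 3 * 4 by rfl, pow_mul, h3]; norm_num)

section dihedral

variable {p : ℕ} [Fact p.Prime]

theorem mem_zpowers_neg_one {R : Type} [Ring R] {x : Rˣ} (hx : x ∈ Subgroup.zpowers (-1 : Rˣ)) :
    x = 1 ∨ x = -1 := by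
  obtain ⟨k, rfl⟩ := hx
  rcases Int.even_or_odd k with hk | hk
  · exact Or.inl hk.neg_one_zpow
  · exact Or.inr hk.neg_one_zpow

theorem card_zpowers_neg_one (hp : p ≠ 2) :
    Nat.card (Subgroup.zpowers (-1 : (ZMod p)ˣ)) = 2 := by
  rw [Nat.card_zpowers, ← orderOf_units, Units.val_neg, Units.val_one, orderOf_neg_one,
    ZMod.ringChar_zmod_n, if_neg hp]

theorem index_zpowers_neg_one (hp : p ≠ 2) :
    ((Subgroup.zpowers (-1 : (ZMod p)ˣ)).index : ℝ) = (p - 1) / 2 := by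
  have h := Subgroup.card_mul_index (Subgroup.zpowers (-1 : (ZMod p)ˣ))
  rw [card_zpowers_neg_one hp, Nat.card_eq_fintype_card, ZMod.card_units] at h
  have h' : (2 * (Subgroup.zpowers (-1 : (ZMod p)ˣ)).index + 1 : ℝ) = p := by
    have := (Fact.out : p.Prime).pos
    exact_mod_cast (by omega : 2 * (Subgroup.zpowers (-1 : (ZMod p)ˣ)).index + 1 = p)
  linarith

theorem sum_zpowers_neg_one [Fintype (Subgroup.zpowers (-1 : (ZMod p)ˣ))] (hp : p ≠ 2)
    (f : (ZMod p)ˣ → ℂ) :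
    ∑ x : Subgroup.zpowers (-1 : (ZMod p)ˣ), f x = f 1 + f (-1) := by
  have hne : (1 : (ZMod p)ˣ) ≠ -1 := by
    intro h
    have h2 := card_zpowers_neg_one hp
    rw [← h] at h2
    simp at h2
  have huniv : (Finset.univ : Finset (Subgroup.zpowers (-1 : (ZMod p)ˣ))) =
      {1, ⟨-1, Subgroup.mem_zpowers _⟩} := by
    ext x
    simp only [Finset.mem_univ, Finset.mem_insert, Finset.mem_singleton, true_iff, Subtype.ext_iff]
    exact mem_zpowers_neg_one x.2
  rw [huniv, Finset.sum_pair (fun h ↦ hne (congrArg Subtype.val h))]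
  simp

theorem primitive_ne_one {ψ : AddChar (ZMod p) ℂ} (hψ : ψ.IsPrimitive) {a : ZMod p} (ha : a ≠ 0) :
    ψ a ≠ 1 := by
  intro h
  refine hψ ha (DFunLike.ext _ _ fun x ↦ ?_)
  rw [AddChar.mulShift_apply, AddChar.one_apply, ← ZMod.natCast_zmod_val x, mul_comm,
    ← nsmul_eq_mul, AddChar.map_nsmul_eq_pow, h, one_pow]

theorem le_valueProportion_dihedral (hp : 3 < p) {ψ : AddChar (ZMod p) ℂ} (hψ : ψ.IsPrimitive) :
    ((p - 1) / (p + 3) * ((p - 1) / (2 * p)) : ℝ) ≤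
      valueProportion (AffineMaps.irredChar (Subgroup.zpowers (-1 : (ZMod p)ˣ)) ψ)
        (fun z ↦ ¬ (z = 0 ∨ IsRootOfUnity z)) := by
  have hp2 : p ≠ 2 := by omega
  have hprime : p.Prime := Fact.out
  have hp0 : (0 : ℝ) < p := Nat.cast_pos.2 hprime.pos
  set B := Subgroup.zpowers (-1 : (ZMod p)ˣ)
  have hcop : p.Coprime 12 := by
    rw [hprime.coprime_iff_not_dvd, show 12 = 2 ^ 2 * 3 by rfl, hprime.dvd_mul]
    rintro (h | h)
    · exact hp2 ((Nat.prime_dvd_prime_iff_eq hprime Nat.prime_two).1 (hprime.dvd_of_dvd_pow h))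
    · exact hp.ne' ((Nat.prime_dvd_prime_iff_eq hprime Nat.prime_three).1 h)
  have hle : Nat.card (((ZMod p)ˣ ⧸ B) × (ZMod p)ˣ) ≤
      Nat.card {q : (AddChar (Additive B) ℂ ⊕ ((ZMod p)ˣ ⧸ B)) × AffineMaps B |
        ¬ (AffineMaps.irredChar B ψ q.1 q.2 = 0 ∨
          IsRootOfUnity (AffineMaps.irredChar B ψ q.1 q.2))} := by
    refine Nat.card_le_card_of_injective (fun q ↦ ⟨(Sum.inr q.1, ⟨q.2, 1⟩), ?_⟩) ?_
    · have hval : AffineMaps.irredChar B ψ (Sum.inr q.1) ⟨q.2, 1⟩ =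
          ψ (q.2 * q.1.out) + (ψ (q.2 * q.1.out))⁻¹ := by
        rw [AffineMaps.irredChar_inr, if_pos rfl]
        convert sum_zpowers_neg_one hp2 fun x ↦ ψ (q.2 * ((q.1.out : ZMod p) * x)) using 1
        · congr!
        · simp [AddChar.map_neg_eq_inv]
      simp only [Set.mem_ofPred_eq, hval]
      refine add_inv_not_isRootOfUnity hcop ?_ (primitive_ne_one hψ (by simp))
      rw [← AddChar.map_nsmul_eq_pow]
      simp
    · rintro ⟨c, u⟩ ⟨d, v⟩ h
      have h' := congrArg Subtype.val h
      simp only [Prod.mk.injEq, Sum.inr.injEq, AffineMaps.mk.injEq, and_true] at h'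
      exact Prod.ext h'.1 (Units.ext h'.2)
  rw [Nat.card_prod, Nat.card_eq_fintype_card (α := (ZMod p)ˣ), ZMod.card_units] at hle
  have hle' : (B.index : ℝ) * (p - 1) ≤
      Nat.card {q : (AddChar (Additive B) ℂ ⊕ ((ZMod p)ˣ ⧸ B)) × AffineMaps B |
        ¬ (AffineMaps.irredChar B ψ q.1 q.2 = 0 ∨
          IsRootOfUnity (AffineMaps.irredChar B ψ q.1 q.2))} := by
    rw [← Nat.cast_pred hprime.pos]
    exact_mod_cast hle
  rw [valueProportion, AffineMaps.card_index, AffineMaps.card_eq, card_zpowers_neg_one hp2]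
  refine le_trans (le_of_eq ?_) (div_le_div_of_nonneg_right hle' (by positivity))
  push_cast
  rw [index_zpowers_neg_one hp2, Nat.card_zmod, show (2 + (p - 1) / 2 : ℝ) = (p + 3) / 2 by ring]
  have : (0 : ℝ) < p + 3 := by positivity
  field_simp

theorem valueProportion_dihedral_le (hp : 3 < p) (ψ : AddChar (ZMod p) ℂ) :
    valueProportion (AffineMaps.irredChar (Subgroup.zpowers (-1 : (ZMod p)ˣ)) ψ) (· ≠ 0) ≤
      (p + 7) / (2 * (p + 3)) := by
  have hp2 : p ≠ 2 := by omega
  refine (AffineMaps.valueProportion_ne_zero_le ψ).trans_eq ?_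
  rw [card_zpowers_neg_one hp2, index_zpowers_neg_one hp2]
  have : (0 : ℝ) < p + 3 := by positivity
  push_cast
  rw [show (2 + (p - 1) / 2 : ℝ) = (p + 3) / 2 by ring]
  field_simp
  ring

end dihedral

/-- Dirichlet's theorem for the two simultaneous congruences `p ≡ 1 [MOD u]` and
`p ≡ -1 [MOD v]`. -/
theorem exists_prime_dvd_sub_one_dvd_add_one {u v : ℕ} (hu : 0 < u) (hv : 0 < v)
    (huv : u.Coprime v) (N : ℕ) : ∃ p > N, p.Prime ∧ u ∣ p - 1 ∧ v ∣ p + 1 := by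
  obtain ⟨s, t, hst⟩ := Nat.isCoprime_iff_coprime.2 huv
  have hcop : IsCoprime (t * v - s * u : ℤ) ((u * v : ℕ) : ℤ) := by
    push_cast
    refine IsCoprime.mul_right ⟨1, 2 * s, ?_⟩ ⟨-1, 2 * t, ?_⟩ <;> linear_combination hst
  obtain ⟨p, hN, hp, hmod⟩ :=
    Nat.forall_exists_prime_gt_and_zmodEq N (Nat.mul_pos hu hv).ne' hcop
  obtain ⟨k, hk⟩ := hmod.dvd
  push_cast at hk
  refine ⟨p, hN, hp, ?_, ?_⟩
  · rw [← Int.natCast_dvd_natCast, Nat.cast_sub hp.one_le]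
    exact ⟨-2 * s - v * k, by push_cast; linear_combination -hk + hst⟩
  · rw [← Int.natCast_dvd_natCast]
    exact ⟨2 * t - u * k, by push_cast; linear_combination -hk - hst⟩

theorem exists_coprime_near {t δ : ℝ} (ht0 : 0 ≤ t) (ht1 : t ≤ 1) (hδ : 0 < δ) :
    ∃ u v : ℕ, 0 < u ∧ 0 < v ∧ u.Coprime v ∧ |(u ^ 2 / (u ^ 2 + v ^ 2) : ℝ) - t| < δ := by
  obtain ⟨s, hs1, hs2⟩ := exists_between (show max 0 (t - δ) < min 1 (t + δ) by
    simp only [max_lt_iff, lt_min_iff]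
    refine ⟨⟨?_, ?_⟩, ?_, ?_⟩ <;> linarith)
  obtain ⟨hs0, hst⟩ := max_lt_iff.1 hs1
  obtain ⟨hs1, hst'⟩ := lt_min_iff.1 hs2
  let f : ℝ → ℝ := fun x ↦ x ^ 2 / (x ^ 2 + 1)
  have hf : Continuous f := by
    refine Continuous.div (by fun_prop) (by fun_prop) fun x ↦ ?_
    positivity
  have hx : f (Real.sqrt (s / (1 - s))) = s := by
    have h1 : 0 < 1 - s := by linarith
    simp only [f, Real.sq_sqrt (div_pos hs0 h1).le]
    field_simp
    ring
  obtain ⟨q, hq0, hq⟩ := Rat.denseRange_cast.exists_mem_open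
    (isOpen_Ioi.inter (isOpen_Ioo.preimage hf) : IsOpen (Set.Ioi 0 ∩ f ⁻¹' Set.Ioo (t - δ) (t + δ)))
    ⟨Real.sqrt (s / (1 - s)), Real.sqrt_pos.2 (div_pos hs0 (by linarith)),
      by rw [Set.mem_preimage, hx]; exact ⟨hst, hst'⟩⟩
  have hqpos : 0 < q := Rat.cast_pos.1 (Set.mem_Ioi.1 hq0)
  have hnum : 0 < q.num := Rat.num_pos.2 hqpos
  refine ⟨q.num.natAbs, q.den, Int.natAbs_pos.2 hnum.ne', q.den_pos, q.reduced, ?_⟩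
  have hcast : (q : ℝ) = (q.num.natAbs : ℝ) / q.den := by
    rw [Nat.cast_natAbs, abs_of_pos hnum, ← Rat.cast_def]
  have hden : (0 : ℝ) < q.den := Nat.cast_pos.2 q.den_pos
  have hval : f q = (q.num.natAbs : ℝ) ^ 2 / ((q.num.natAbs : ℝ) ^ 2 + (q.den : ℝ) ^ 2) := by
    simp only [f, hcast]
    field_simp
  rw [← hval, abs_lt]
  constructor <;> linarith [hq.1, hq.2]

theorem exists_subgroup_card_eq {C : Type} [Group C] [Finite C] [IsCyclic C] {h r : ℕ}
    (hC : h * r = Nat.card C) : ∃ B : Subgroup C, Nat.card B = h ∧ B.index = r := by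
  obtain ⟨g, hg⟩ := IsCyclic.exists_generator (α := C)
  have hord : orderOf g = h * r := by rw [hC, orderOf_eq_card_of_forall_mem_zpowers hg]
  have hpos : 0 < h * r := hC ▸ Nat.card_pos
  have hcard : Nat.card (Subgroup.zpowers (g ^ r)) = h := by
    rw [Nat.card_zpowers, orderOf_pow_of_dvd (Nat.pos_of_mul_pos_left hpos).ne' ⟨h, by
      rw [hord, mul_comm]⟩, hord, Nat.mul_div_cancel _ (Nat.pos_of_mul_pos_left hpos)]
  refine ⟨_, hcard, ?_⟩
  have := Subgroup.card_mul_index (Subgroup.zpowers (g ^ r))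
  rw [hcard, ← hC] at this
  exact Nat.eq_of_mul_eq_mul_left (Nat.pos_of_mul_pos_right hpos) this

theorem AffineMaps.one_sub_thetaG_prod_bounds {F K : Type} [Field F] [Fintype F] [Field K]
    [Fintype K] (A : Subgroup Fˣ) (B : Subgroup Kˣ) {ψ : AddChar F ℂ} {φ : AddChar K ℂ}
    (hψ : ψ.IsPrimitive) (hφ : φ.IsPrimitive) :
    valueProportion (irredChar A ψ) (fun z ↦ ¬ (z = 0 ∨ IsRootOfUnity z)) *
          (Nat.card B / (Nat.card B + B.index)) ≤ 1 - thetaG (AffineMaps A × AffineMaps B) ∧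
      1 - thetaG (AffineMaps A × AffineMaps B) ≤ valueProportion (irredChar A ψ) (· ≠ 0) *
        (Nat.card B / (Nat.card B + B.index) +
          B.index / (Nat.card B + B.index) / Nat.card B) := by
  obtain ⟨hlow, hupp⟩ := _root_.one_sub_thetaG_prod_bounds
    (isCharacterTable_irredChar (B := A) hψ) (isCharacterTable_irredChar (B := B) hφ)
  exact ⟨(mul_le_mul_of_nonneg_left (le_valueProportion_isRootOfUnity φ)
      (valueProportion_nonneg _ _)).trans hlow,
    hupp.trans (mul_le_mul_of_nonneg_left (valueProportion_ne_zero_le φ)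
      (valueProportion_nonneg _ _))⟩

theorem thetaG_prod_affineMaps_bounds {p u v : ℕ} [Fact p.Prime] (hp3 : 3 < p) (hu : 0 < u)
    (hv : 0 < v) {F : Type} [Field F] [Fintype F] {φ : AddChar F ℂ} (hφ : φ.IsPrimitive)
    {B : Subgroup Fˣ} (hB : (Nat.card B : ℝ) = (p + 1) / v * u)
    (hBi : (B.index : ℝ) = (p - 1) / u * v) :
    ((p - 1) / (p + 3) * ((p - 1) / (2 * p)) *
        ((p + 1) * u ^ 2 / ((p + 1) * u ^ 2 + (p - 1) * v ^ 2)) : ℝ) ≤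
        1 - thetaG (AffineMaps (Subgroup.zpowers (-1 : (ZMod p)ˣ)) × AffineMaps B) ∧
      1 - thetaG (AffineMaps (Subgroup.zpowers (-1 : (ZMod p)ˣ)) × AffineMaps B) ≤
        ((p + 7) / (2 * (p + 3)) *
          ((p + 1) * u ^ 2 / ((p + 1) * u ^ 2 + (p - 1) * v ^ 2) + v / ((p + 1) * u)) : ℝ) := by
  have hp1 : (3 : ℝ) < p := by exact_mod_cast hp3
  have hur : (0 : ℝ) < u := Nat.cast_pos.2 hu
  have hvr : (0 : ℝ) < v := Nat.cast_pos.2 hv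
  have hpm : (0 : ℝ) < p - 1 := by linarith
  have hlin : (Nat.card B : ℝ) / (Nat.card B + B.index) =
      (p + 1) * u ^ 2 / ((p + 1) * u ^ 2 + (p - 1) * v ^ 2) := by
    rw [hB, hBi]
    field_simp
  have hinv : (B.index : ℝ) / (Nat.card B + B.index) / Nat.card B ≤ v / ((p + 1) * u) := by
    have h1 : (v : ℝ) / ((p + 1) * u) = 1 / Nat.card B := by
      rw [hB]
      field_simp
    rw [h1]
    gcongr
    exact div_le_one_of_le₀ (by linarith [(Nat.card B).cast_nonneg (α := ℝ)]) (by positivity)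
  have hψ := AddChar.FiniteField.primitiveChar_to_Complex_isPrimitive (ZMod p)
  obtain ⟨hlow, hupp⟩ :=
    AffineMaps.one_sub_thetaG_prod_bounds (Subgroup.zpowers (-1 : (ZMod p)ˣ)) B hψ hφ
  rw [hlin] at hlow hupp
  refine ⟨le_trans ?_ hlow, hupp.trans ?_⟩
  · exact mul_le_mul_of_nonneg_right (le_valueProportion_dihedral hp3 hψ) (by positivity)
  · exact mul_le_mul (valueProportion_dihedral_le hp3 _) (by gcongr) (by positivity)
      (by positivity)

theorem exists_thetaG_bounds_of_card {p u v : ℕ} [Fact p.Prime] (hp3 : 3 < p) (hu : 0 < u)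
    (hv : 0 < v) (hup : u ∣ p - 1) (hvp : v ∣ p + 1) {F : Type} [Field F] [Fintype F]
    (hF : Nat.card F = p ^ 2) {φ : AddChar F ℂ} (hφ : φ.IsPrimitive) :
    ∃ (G : Type) (_ : Group G) (_ : Fintype G),
      ((p - 1) / (p + 3) * ((p - 1) / (2 * p)) *
          ((p + 1) * u ^ 2 / ((p + 1) * u ^ 2 + (p - 1) * v ^ 2)) : ℝ) ≤ 1 - thetaG G ∧
        1 - thetaG G ≤ ((p + 7) / (2 * (p + 3)) *
          ((p + 1) * u ^ 2 / ((p + 1) * u ^ 2 + (p - 1) * v ^ 2) + v / ((p + 1) * u)) : ℝ) := by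
  obtain ⟨a, ha⟩ := hup
  obtain ⟨b, hb⟩ := hvp
  have hcard : (b * u) * (a * v) = Nat.card Fˣ := by
    rw [Nat.card_units, hF, show p ^ 2 - 1 = (p + 1) * (p - 1) by simpa using Nat.sq_sub_sq p 1,
      ha, hb]
    ring
  obtain ⟨B, hB, hBi⟩ := exists_subgroup_card_eq hcard
  have hur : (0 : ℝ) < u := Nat.cast_pos.2 hu
  have hvr : (0 : ℝ) < v := Nat.cast_pos.2 hv
  have har : (a : ℝ) = (p - 1) / u := by
    rw [eq_div_iff hur.ne', ← Nat.cast_pred (Fact.out : p.Prime).pos, ha, mul_comm]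
    push_cast
    rfl
  have hbr : (b : ℝ) = (p + 1) / v := by
    rw [eq_div_iff hvr.ne', mul_comm]
    exact_mod_cast hb.symm
  refine ⟨AffineMaps (Subgroup.zpowers (-1 : (ZMod p)ˣ)) × AffineMaps B, inferInstance,
    inferInstance, thetaG_prod_affineMaps_bounds hp3 hu hv hφ ?_ ?_⟩
  · rw [hB, ← hbr, Nat.cast_mul]
  · rw [hBi, ← har, Nat.cast_mul]

open Filter Topology in
theorem tendsto_bounds {u v : ℝ} (hu : 0 < u) (hv : 0 < v) :
    Tendsto (fun x : ℝ ↦ (x - 1) / (x + 3) * ((x - 1) / (2 * x)) *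
        ((x + 1) * u ^ 2 / ((x + 1) * u ^ 2 + (x - 1) * v ^ 2))) atTop
        (𝓝 (u ^ 2 / (u ^ 2 + v ^ 2) / 2)) ∧
      Tendsto (fun x : ℝ ↦ (x + 7) / (2 * (x + 3)) *
        ((x + 1) * u ^ 2 / ((x + 1) * u ^ 2 + (x - 1) * v ^ 2) + v / ((x + 1) * u))) atTop
        (𝓝 (u ^ 2 / (u ^ 2 + v ^ 2) / 2)) := by
  have huv : u ^ 2 + v ^ 2 ≠ 0 := by positivity
  constructor
  · have hc : ContinuousAt (fun y : ℝ ↦ (1 - y) / (1 + 3 * y) * ((1 - y) / 2) *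
        ((1 + y) * u ^ 2 / ((1 + y) * u ^ 2 + (1 - y) * v ^ 2))) 0 := by
      refine ContinuousAt.mul (ContinuousAt.mul ?_ ?_) ?_ <;>
        refine ContinuousAt.div (by fun_prop) (by fun_prop) (by simp [huv])
    have h := hc.tendsto.comp tendsto_inv_atTop_zero
    have h0 : (1 - 0) / (1 + 3 * 0) * ((1 - 0) / 2) *
        ((1 + 0) * u ^ 2 / ((1 + 0) * u ^ 2 + (1 - 0) * v ^ 2)) = u ^ 2 / (u ^ 2 + v ^ 2) / 2 := by
      ring
    rw [h0] at h
    refine h.congr' ?_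
    filter_upwards [eventually_gt_atTop 1] with x hx
    have hx1 : 0 < x - 1 := by linarith
    have hx0 : 0 < x := by linarith
    have hxi : 1 - x⁻¹ = (x - 1) / x := by field_simp
    simp only [Function.comp_apply, hxi]
    field_simp
  · have hc : ContinuousAt (fun y : ℝ ↦ (1 + 7 * y) / (2 * (1 + 3 * y)) *
        ((1 + y) * u ^ 2 / ((1 + y) * u ^ 2 + (1 - y) * v ^ 2) + y * v / ((1 + y) * u))) 0 := by
      refine ContinuousAt.mul ?_ (ContinuousAt.add ?_ ?_) <;>
        refine ContinuousAt.div (by fun_prop) (by fun_prop) (by simp [huv, hu.ne'])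
    have h := hc.tendsto.comp tendsto_inv_atTop_zero
    have h0 : (1 + 7 * 0) / (2 * (1 + 3 * 0)) *
        ((1 + 0) * u ^ 2 / ((1 + 0) * u ^ 2 + (1 - 0) * v ^ 2) + 0 * v / ((1 + 0) * u)) =
        u ^ 2 / (u ^ 2 + v ^ 2) / 2 := by
      ring
    rw [h0] at h
    refine h.congr' ?_
    filter_upwards [eventually_gt_atTop 1] with x hx
    have hx1 : 0 < x - 1 := by linarith
    have hx0 : 0 < x := by linarith
    have hxi : 1 - x⁻¹ = (x - 1) / x := by field_simp
    simp only [Function.comp_apply, hxi]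
    field_simp

/-- Denseness of values of `thetaG` on finite groups. -/
theorem denseness_theta_group (L : ℝ) (hL1 : 1 / 2 ≤ L) (hL2 : L ≤ 1) (ε : ℝ) (hε : 0 < ε) :
    ∃ (G : Type) (_ : Group G) (_ : Fintype G), |thetaG G - L| < ε := by
  obtain ⟨u, v, hu, hv, huv, hnear⟩ :=
    exists_coprime_near (t := 2 * (1 - L)) (by linarith) (by linarith) hε
  obtain ⟨hlow, hupp⟩ := tendsto_bounds (u := u) (v := v) (Nat.cast_pos.2 hu) (Nat.cast_pos.2 hv)
  rw [abs_lt] at hnear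
  obtain ⟨N, hN⟩ := Filter.eventually_atTop.1 <| tendsto_natCast_atTop_atTop.eventually <|
    (hlow.eventually (lt_mem_nhds (show 1 - L - ε < _ by linarith))).and
      (hupp.eventually (gt_mem_nhds (show _ < 1 - L + ε by linarith)))
  obtain ⟨p, hpN, hp, hup, hvp⟩ := exists_prime_dvd_sub_one_dvd_add_one hu hv huv (max N 3)
  obtain ⟨hpN, hp3⟩ := max_lt_iff.1 hpN
  have : Fact p.Prime := ⟨hp⟩
  have : Fintype (GaloisField p 2) := Fintype.ofFinite _
  obtain ⟨G, hG, hGf, hle, hge⟩ := exists_thetaG_bounds_of_card hp3 hu hv hup hvp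
    (GaloisField.card p 2 two_ne_zero)
    (AddChar.FiniteField.primitiveChar_to_Complex_isPrimitive (GaloisField p 2))
  obtain ⟨h1, h2⟩ := hN p hpN.le
  exact ⟨G, hG, hGf, abs_lt.2 ⟨by linarith, by linarith⟩⟩
end
end

section
/- For any real number L with 0 ≤ L ≤ 1 and any ε > 0, there exists a finite group G such that |z_II(G) − L| < ε. -/
open scoped Classical

noncomputable section

section Characters

variable {G H : Type} [Group G] [Group H]

theorem IsIrredChar.conj_eq {χ : G → ℂ} (hχ : IsIrredChar χ) (g h : G) :
    χ (h * g * h⁻¹) = χ g := by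
  obtain ⟨V, -, rfl⟩ := hχ
  exact V.char_conj g h

theorem IsIrredChar.sum_mul_inv_self [Fintype G] {χ : G → ℂ} (hχ : IsIrredChar χ) :
    ∑ g, χ g * χ g⁻¹ = Nat.card G := by
  obtain ⟨V, hV, rfl⟩ := hχ
  exact (FDRep.simple_iff_char_is_norm_one V).1 hV

theorem IsIrredChar.sum_mul_inv_eq_zero [Fintype G] {χ ψ : G → ℂ} (hχ : IsIrredChar χ)
    (hψ : IsIrredChar ψ) (hne : χ ≠ ψ) : ∑ g, χ g * ψ g⁻¹ = 0 := by
  obtain ⟨V, hV, rfl⟩ := hχ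
  obtain ⟨W, hW, rfl⟩ := hψ
  have h0 : (Nat.card G : ℂ) ≠ 0 := NeZero.ne _
  have := invertibleOfNonzero h0
  have h := FDRep.char_orthonormal V W
  rw [if_neg fun ⟨i⟩ ↦ hne (FDRep.char_iso i)] at h
  exact (mul_eq_zero.1 h).resolve_left (inv_ne_zero h0)

/-- The representation `V ⊗ W` of `G × H` has character `χ_V(g) χ_W(h)`. -/
theorem exists_character_prod (V : FDRep ℂ G) (W : FDRep ℂ H) :
    ∃ U : FDRep ℂ (G × H), U.character = fun p ↦ V.character p.1 * W.character p.2 := by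
  refine ⟨FDRep.of (Representation.tprod (V.ρ.comp (MonoidHom.fst G H))
    (W.ρ.comp (MonoidHom.snd G H))), ?_⟩
  funext p
  exact LinearMap.trace_tensorProduct' (V.ρ p.1) (W.ρ p.2)

theorem exists_character_matrix {ι : Type} [Fintype ι] [DecidableEq ι] (φ : G →* Matrix ι ι ℂ) :
    ∃ U : FDRep ℂ G, U.character = fun g ↦ (φ g).trace := by
  refine ⟨FDRep.of ((Matrix.toLinAlgEquiv' : Matrix ι ι ℂ ≃ₐ[ℂ] _).toRingEquiv.toMonoidHom.comp φ),
    ?_⟩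
  funext g
  exact Matrix.trace_toLin'_eq (φ g)

theorem isIrredChar_of_matrix [Fintype G] {ι : Type} [Fintype ι] [DecidableEq ι]
    (φ : G →* Matrix ι ι ℂ)
    (h : ∑ g, (φ g).trace * (φ g⁻¹).trace = Nat.card G) :
    IsIrredChar fun g ↦ (φ g).trace := by
  obtain ⟨U, hU⟩ := exists_character_matrix φ
  exact ⟨U, (FDRep.simple_iff_char_is_norm_one U).2 (by rw [hU]; exact h), hU.symm⟩

theorem sum_prod_mul_prod [Fintype G] [Fintype H] (a b : G → ℂ) (c d : H → ℂ) :
    ∑ p : G × H, a p.1 * c p.2 * (b p.1⁻¹ * d p.2⁻¹) =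
      (∑ g, a g * b g⁻¹) * ∑ h, c h * d h⁻¹ := by
  rw [Finset.sum_mul_sum, Fintype.sum_prod_type]
  exact Finset.sum_congr rfl fun g _ ↦ Finset.sum_congr rfl fun h _ ↦ by ring

theorem IsIrredChar.prod [Fintype G] [Fintype H] {χ : G → ℂ} {ψ : H → ℂ} (hχ : IsIrredChar χ)
    (hψ : IsIrredChar ψ) : IsIrredChar fun p : G × H ↦ χ p.1 * ψ p.2 := by
  have h1 := hχ.sum_mul_inv_self
  have h2 := hψ.sum_mul_inv_self
  obtain ⟨V, -, rfl⟩ := hχ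
  obtain ⟨W, -, rfl⟩ := hψ
  obtain ⟨U, hU⟩ := exists_character_prod V W
  refine ⟨U, (FDRep.simple_iff_char_is_norm_one U).2 ?_, hU.symm⟩
  rw [hU]
  refine (sum_prod_mul_prod _ _ _ _).trans ?_
  rw [h1, h2, Nat.card_prod, Nat.cast_mul]

theorem IsIrredChar.prod_injective [Fintype G] [Fintype H] {χ χ' : G → ℂ} {ψ ψ' : H → ℂ}
    (hχ : IsIrredChar χ) (hψ : IsIrredChar ψ) (hχ' : IsIrredChar χ') (hψ' : IsIrredChar ψ')
    (h : (fun p : G × H ↦ χ p.1 * ψ p.2) = fun p ↦ χ' p.1 * ψ' p.2) : χ = χ' ∧ ψ = ψ' := by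
  have h1 := (hχ.prod hψ).sum_mul_inv_self
  have h2 : ∑ p : G × H, χ p.1 * ψ p.2 * (χ' p.1⁻¹ * ψ' p.2⁻¹) = Nat.card (G × H) := by
    rw [← h1]
    exact Finset.sum_congr rfl fun p _ ↦ by rw [congrFun h p⁻¹]; rfl
  rw [sum_prod_mul_prod] at h2
  have h0 : (Nat.card (G × H) : ℂ) ≠ 0 := NeZero.ne _
  rw [← h2] at h0
  exact ⟨by_contra fun hn ↦ h0 (by rw [hχ.sum_mul_inv_eq_zero hχ' hn, zero_mul]),
    by_contra fun hn ↦ h0 (by rw [hψ.sum_mul_inv_eq_zero hψ' hn, mul_zero])⟩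

variable (G) in
/-- No nonzero class function on `G` is orthogonal to all irreducible characters. -/
def IrredCharsComplete [Fintype G] : Prop :=
  ∀ f : G → ℂ, (∀ g h, f (h * g * h⁻¹) = f g) →
    (∀ χ : G → ℂ, IsIrredChar χ → ∑ g, f g * χ g⁻¹ = 0) → f = 0

theorem IrredCharsComplete.eq_zero_of_prod [Fintype G] [Fintype H] (hG : IrredCharsComplete G)
    (hH : IrredCharsComplete H) {f : G × H → ℂ} (hf : ∀ g h, f (h * g * h⁻¹) = f g)
    (h0 : ∀ (χ : G → ℂ) (ψ : H → ℂ), IsIrredChar χ → IsIrredChar ψ →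
      ∑ p : G × H, f p * (χ p.1⁻¹ * ψ p.2⁻¹) = 0) : f = 0 := by
  have key : ∀ χ : G → ℂ, IsIrredChar χ → (fun h ↦ ∑ g, f (g, h) * χ g⁻¹) = 0 := by
    intro χ hχ
    refine hH _ (fun h k ↦ Finset.sum_congr rfl fun g _ ↦ ?_) fun ψ hψ ↦ ?_
    · rw [← hf (g, h) (1, k)]
      simp
    · rw [← h0 χ ψ hχ hψ, Fintype.sum_prod_type_right]
      refine Finset.sum_congr rfl fun h _ ↦ ?_
      rw [Finset.sum_mul]
      exact Finset.sum_congr rfl fun g _ ↦ by ring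
  funext p
  obtain ⟨g, h⟩ := p
  refine congrFun (hG (fun g ↦ f (g, h)) (fun g k ↦ ?_) fun χ hχ ↦ congrFun (key χ hχ) h) g
  rw [← hf (g, h) (k, 1)]
  simp

theorem IrredCharsComplete.prod [Fintype G] [Fintype H] (hG : IrredCharsComplete G)
    (hH : IrredCharsComplete H) : IrredCharsComplete (G × H) :=
  fun _ hf h0 ↦ hG.eq_zero_of_prod hH hf fun _ _ hχ hψ ↦ h0 _ (hχ.prod hψ)

theorem IsIrredChar.exists_eq_prod [Fintype G] [Fintype H] (hG : IrredCharsComplete G)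
    (hH : IrredCharsComplete H) {θ : G × H → ℂ} (hθ : IsIrredChar θ) :
    ∃ (χ : G → ℂ) (ψ : H → ℂ), IsIrredChar χ ∧ IsIrredChar ψ ∧ (fun p ↦ χ p.1 * ψ p.2) = θ := by
  by_contra! hn
  have h0 : θ = 0 := hG.eq_zero_of_prod hH hθ.conj_eq fun χ ψ hχ hψ ↦
    hθ.sum_mul_inv_eq_zero (hχ.prod hψ) (hn χ ψ hχ hψ).symm
  have h1 := hθ.sum_mul_inv_self
  simp [h0] at h1

/-- The bijection `Irr(G) × Irr(H) ≃ Irr(G × H)`. -/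
def irrProdEquiv [Fintype G] [Fintype H] (hG : IrredCharsComplete G) (hH : IrredCharsComplete H) :
    {χ : G → ℂ | IsIrredChar χ} × {ψ : H → ℂ | IsIrredChar ψ} ≃
      {θ : G × H → ℂ | IsIrredChar θ} :=
  Equiv.ofBijective (fun x ↦ ⟨fun p ↦ x.1.1 p.1 * x.2.1 p.2, x.1.2.prod x.2.2⟩) <| by
    constructor
    · rintro ⟨⟨χ, hχ⟩, ψ, hψ⟩ ⟨⟨χ', hχ'⟩, ψ', hψ'⟩ h
      obtain ⟨rfl, rfl⟩ := hχ.prod_injective hψ hχ' hψ' (Subtype.ext_iff.1 h)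
      rfl
    · rintro ⟨θ, hθ⟩
      obtain ⟨χ, ψ, hχ, hψ, rfl⟩ := IsIrredChar.exists_eq_prod hG hH hθ
      exact ⟨⟨⟨χ, hχ⟩, ψ, hψ⟩, rfl⟩

variable (G H) in
/-- The conjugacy classes of `G × H` are the products of conjugacy classes of `G` and `H`. -/
def conjClassesProdEquiv : ConjClasses (G × H) ≃ ConjClasses G × ConjClasses H :=
  Equiv.ofBijective
    (fun C ↦ (ConjClasses.map (MonoidHom.fst G H) C, ConjClasses.map (MonoidHom.snd G H) C)) <| by
    constructor
    · intro C D
      induction C using Quotient.inductionOn with | h a => ?_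
      induction D using Quotient.inductionOn with | h b => ?_
      intro h
      obtain ⟨h1, h2⟩ := Prod.mk.inj h
      obtain ⟨c, hc⟩ := isConj_iff.1 (ConjClasses.mk_eq_mk_iff_isConj.1 h1)
      obtain ⟨d, hd⟩ := isConj_iff.1 (ConjClasses.mk_eq_mk_iff_isConj.1 h2)
      exact ConjClasses.mk_eq_mk_iff_isConj.2 (isConj_iff.2 ⟨(c, d), Prod.ext hc hd⟩)
    · rintro ⟨C, D⟩
      induction C using Quotient.inductionOn with | h a => ?_
      induction D using Quotient.inductionOn with | h b => ?_
      exact ⟨ConjClasses.mk (a, b), rfl⟩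

variable (G) in
/-- The pairs `(χ, C) ∈ Irr(G) × Cl(G)` such that `χ` does not vanish on `C`. -/
def nonzeroPairs : Set ({χ : G → ℂ | IsIrredChar χ} × ConjClasses G) :=
  {p | ∃ g, ConjClasses.mk g = p.2 ∧ p.1.1 g ≠ 0}

theorem mk_mem_nonzeroPairs {χ : {χ : G → ℂ | IsIrredChar χ}} {g : G} :
    (χ, ConjClasses.mk g) ∈ nonzeroPairs G ↔ χ.1 g ≠ 0 := by
  refine ⟨?_, fun h ↦ ⟨g, rfl, h⟩⟩
  rintro ⟨k, hk, h⟩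
  obtain ⟨c, rfl⟩ := isConj_iff.1 (ConjClasses.mk_eq_mk_iff_isConj.1 hk)
  rwa [IsIrredChar.conj_eq χ.2]

theorem card_nonzeroPairs_prod [Fintype G] [Fintype H] (hG : IrredCharsComplete G)
    (hH : IrredCharsComplete H) :
    Nat.card (nonzeroPairs (G × H)) = Nat.card (nonzeroPairs G) * Nat.card (nonzeroPairs H) := by
  rw [← Nat.card_prod]
  refine Nat.card_congr (Equiv.symm ?_)
  refine (Equiv.Set.prod (nonzeroPairs G) (nonzeroPairs H)).symm.trans ?_
  refine Equiv.subtypeEquiv ((Equiv.prodProdProdComm _ _ _ _).trans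
    (Equiv.prodCongr (irrProdEquiv hG hH) (conjClassesProdEquiv G H).symm)) ?_
  rintro ⟨⟨χ, C⟩, ψ, D⟩
  induction C using Quotient.inductionOn with | h a => ?_
  induction D using Quotient.inductionOn with | h b => ?_
  have hcl : (conjClassesProdEquiv G H).symm (ConjClasses.mk a, ConjClasses.mk b) =
      ConjClasses.mk (a, b) := (Equiv.symm_apply_eq _).2 rfl
  change _ ∧ _ ↔ (irrProdEquiv hG hH (χ, ψ),
    (conjClassesProdEquiv G H).symm (ConjClasses.mk a, ConjClasses.mk b)) ∈ nonzeroPairs (G × H)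
  rw [hcl, mk_mem_nonzeroPairs]
  exact (and_congr mk_mem_nonzeroPairs mk_mem_nonzeroPairs).trans mul_ne_zero_iff.symm

variable (G) in
/-- The proportion of nonzero entries in the character table of `G`. -/
def nonzeroRatio : ℝ :=
  (Nat.card (nonzeroPairs G) : ℝ) /
    ((Nat.card {χ : G → ℂ | IsIrredChar χ} : ℝ) * (Nat.card (ConjClasses G) : ℝ))

theorem nonzeroRatio_prod [Fintype G] [Fintype H] (hG : IrredCharsComplete G)
    (hH : IrredCharsComplete H) :
    nonzeroRatio (G × H) = nonzeroRatio G * nonzeroRatio H := by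
  rw [nonzeroRatio, card_nonzeroPairs_prod hG hH, ← Nat.card_congr (irrProdEquiv hG hH),
    Nat.card_congr (conjClassesProdEquiv G H), Nat.card_prod, Nat.card_prod, nonzeroRatio,
    nonzeroRatio, div_mul_div_comm]
  push_cast
  congr 1
  ring

variable (G) in
theorem card_zeroPairs : Nat.card {p : (G → ℂ) × ConjClasses G |
      IsIrredChar p.1 ∧ ∀ g ∈ p.2.carrier, p.1 g = 0} = Nat.card ↥(nonzeroPairs G)ᶜ := by
  refine Nat.card_congr ⟨fun p ↦ ⟨(⟨p.1.1, p.2.1⟩, p.1.2), ?_⟩,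
    fun p ↦ ⟨(p.1.1.1, p.1.2), p.1.1.2, ?_⟩, fun _ ↦ rfl, fun _ ↦ rfl⟩
  · rintro ⟨g, hg, h⟩
    exact h (p.2.2 g (ConjClasses.mem_carrier_iff_mk_eq.2 hg))
  · intro g hg
    by_contra h
    exact p.2 ⟨g, ConjClasses.mem_carrier_iff_mk_eq.1 hg, h⟩

variable (G) in
theorem zIIG_eq_one_sub [Finite G] [Finite {χ : G → ℂ | IsIrredChar χ}]
    [Nonempty {χ : G → ℂ | IsIrredChar χ}] : zIIG G = 1 - nonzeroRatio G := by
  have h0 : ((Nat.card {χ : G → ℂ | IsIrredChar χ} : ℝ) * (Nat.card (ConjClasses G) : ℝ)) ≠ 0 := by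
    have := Nat.card_pos (α := {χ : G → ℂ | IsIrredChar χ})
    have := Nat.card_pos (α := ConjClasses G)
    positivity
  have h : Nat.card (nonzeroPairs G) + Nat.card ↥(nonzeroPairs G)ᶜ =
      Nat.card {χ : G → ℂ | IsIrredChar χ} * Nat.card (ConjClasses G) := by
    rw [← Nat.card_prod, Nat.card_coe_set_eq, Nat.card_coe_set_eq, Set.ncard_add_ncard_compl]
  have h' : (Nat.card (nonzeroPairs G) : ℝ) + Nat.card ↥(nonzeroPairs G)ᶜ =
      Nat.card {χ : G → ℂ | IsIrredChar χ} * Nat.card (ConjClasses G) := by exact_mod_cast h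
  rw [zIIG, card_zeroPairs, nonzeroRatio, eq_sub_iff_add_eq, ← add_div, add_comm, h', div_self h0]

variable (G) in
theorem exists_group_nonzeroRatio_eq_pow [Fintype G] (hG : IrredCharsComplete G)
    [hfin : Finite {χ : G → ℂ | IsIrredChar χ}] [hne : Nonempty {χ : G → ℂ | IsIrredChar χ}]
    (n : ℕ) :
    ∃ (K : Type) (_ : Group K) (_ : Fintype K), IrredCharsComplete K ∧
      Finite {χ : K → ℂ | IsIrredChar χ} ∧ Nonempty {χ : K → ℂ | IsIrredChar χ} ∧
        nonzeroRatio K = nonzeroRatio G ^ (n + 1) := by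
  induction n with
  | zero => exact ⟨G, _, _, hG, hfin, hne, by simp⟩
  | succ n ih =>
    obtain ⟨K, _, _, hK, h1, h2, h3⟩ := ih
    exact ⟨K × G, inferInstance, inferInstance, hK.prod hG, Finite.of_equiv _ (irrProdEquiv hK hG),
      (irrProdEquiv hK hG).nonempty_congr.1 inferInstance, by
        rw [nonzeroRatio_prod hK hG, h3, ← pow_succ]⟩

end Characters

section Dihedral

open DihedralGroup

variable {n : ℕ}

/-- The linear character of the dihedral group with value `c = ±1` on reflections, as a
one-dimensional matrix representation. -/
def dihedralLinear (n : ℕ) (c : ℂ) (hc : c * c = 1) :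
    DihedralGroup n →* Matrix (Fin 1) (Fin 1) ℂ where
  toFun
    | r _ => 1
    | sr _ => !![c]
  map_one' := rfl
  map_mul' := by
    rintro (a | a) (b | b) <;> ext i j <;> fin_cases i <;> fin_cases j <;> simp [hc]

/-- The two-dimensional matrix representation of the dihedral group in which the rotation `r i` acts
with eigenvalues `exp (± 2 * π * I * j * i / n)`. -/
def dihedralPlane (n : ℕ) [NeZero n] (j : ZMod n) :
    DihedralGroup n →* Matrix (Fin 2) (Fin 2) ℂ where
  toFun
    | r i => !![ZMod.stdAddChar (i * j), 0; 0, ZMod.stdAddChar (-(i * j))]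
    | sr i => !![0, ZMod.stdAddChar (-(i * j)); ZMod.stdAddChar (i * j), 0]
  map_one' := by
    change !![ZMod.stdAddChar ((0 : ZMod n) * j), 0; 0, ZMod.stdAddChar (-((0 : ZMod n) * j))] = _
    simp [Matrix.one_fin_two]
  map_mul' := by
    rintro (a | a) (b | b) <;> simp [← AddChar.map_add_eq_mul] <;> ring_nf <;> simp

theorem dihedral_sum_eq [NeZero n] (f : DihedralGroup n → ℂ) :
    ∑ g, f g = ∑ i, f (r i) + ∑ i, f (sr i) := by
  let e : ZMod n ⊕ ZMod n ≃ DihedralGroup n :=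
    { toFun := Sum.elim r sr
      invFun
        | r i => Sum.inl i
        | sr i => Sum.inr i
      left_inv := by rintro (i | i) <;> rfl
      right_inv := by rintro (i | i) <;> rfl }
  rw [← e.sum_comp, Fintype.sum_sum_type]
  rfl

@[simp]
theorem trace_dihedralLinear_r (c : ℂ) (hc : c * c = 1) (i : ZMod n) :
    (dihedralLinear n c hc (r i)).trace = 1 := by
  change (1 : Matrix (Fin 1) (Fin 1) ℂ).trace = 1
  simp

@[simp]
theorem trace_dihedralLinear_sr (c : ℂ) (hc : c * c = 1) (i : ZMod n) :
    (dihedralLinear n c hc (sr i)).trace = c := by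
  change (!![c]).trace = c
  simp [Matrix.trace]

@[simp]
theorem trace_dihedralPlane_r [NeZero n] (j i : ZMod n) :
    (dihedralPlane n j (r i)).trace = ZMod.stdAddChar (i * j) + ZMod.stdAddChar (-(i * j)) :=
  Matrix.trace_fin_two_of _ _ _ _

@[simp]
theorem trace_dihedralPlane_sr [NeZero n] (j i : ZMod n) :
    (dihedralPlane n j (sr i)).trace = 0 :=
  (Matrix.trace_fin_two_of _ _ _ _).trans (add_zero 0)

theorem isIrredChar_dihedralLinear [NeZero n] (c : ℂ) (hc : c * c = 1) :
    IsIrredChar fun g ↦ (dihedralLinear n c hc g).trace := by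
  refine isIrredChar_of_matrix (dihedralLinear n c hc) ?_
  rw [dihedral_sum_eq, DihedralGroup.nat_card]
  simp [hc]
  ring

theorem ZMod.isUnit_two_of_odd (hn : Odd n) : IsUnit (2 : ZMod n) := by
  simpa using (ZMod.isUnit_iff_coprime 2 n).2 (Nat.coprime_two_left.2 hn)

theorem isIrredChar_dihedralPlane [NeZero n] (hn : Odd n) {j : ZMod n} (hj : j ≠ 0) :
    IsIrredChar fun g ↦ (dihedralPlane n j g).trace := by
  refine isIrredChar_of_matrix (dihedralPlane n j) ?_
  have h2 : 2 * j ≠ 0 := fun h ↦ hj ((ZMod.isUnit_two_of_odd hn).mul_right_eq_zero.1 h)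
  have hs : ∀ k : ZMod n, k ≠ 0 → ∑ i : ZMod n, ZMod.stdAddChar (i * k) = (0 : ℂ) := fun k hk ↦ by
    rw [AddChar.sum_mulShift k (ZMod.isPrimitive_stdAddChar n), if_neg hk, Nat.cast_zero]
  have key : ∀ i : ZMod n, (dihedralPlane n j (r i)).trace * (dihedralPlane n j (r i)⁻¹).trace =
      2 + ZMod.stdAddChar (i * (2 * j)) + ZMod.stdAddChar (i * (-(2 * j))) := by
    intro i
    have e1 : i * (2 * j) = i * j + i * j := by ring
    have e2 : i * (-(2 * j)) = -(i * j) + -(i * j) := by ring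
    have e3 : (ZMod.stdAddChar (i * j) : ℂ) * ZMod.stdAddChar (-(i * j)) = 1 := by
      rw [← AddChar.map_add_eq_mul, add_neg_cancel, AddChar.map_zero_eq_one]
    rw [e1, e2, AddChar.map_add_eq_mul, AddChar.map_add_eq_mul, inv_r, trace_dihedralPlane_r,
      trace_dihedralPlane_r, neg_mul, neg_neg]
    linear_combination 2 * e3
  rw [dihedral_sum_eq, DihedralGroup.nat_card]
  simp only [key, Finset.sum_add_distrib, hs _ h2, hs _ (neg_ne_zero.2 h2)]
  simp
  ring

theorem dihedral_isConj_sr (hn : Odd n) (a : ZMod n) : IsConj (sr 0) (sr a) := by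
  obtain ⟨u, hu⟩ := ZMod.isUnit_two_of_odd hn
  refine isConj_iff.2 ⟨r (-(↑u⁻¹ * a)), ?_⟩
  rw [inv_r, r_mul_sr, sr_mul_r]
  congr 1
  calc 0 - -(↑u⁻¹ * a) + - -(↑u⁻¹ * a) = 2 * (↑u⁻¹ * a) := by ring
    _ = a := by rw [← hu, Units.mul_inv_cancel_left]

theorem dihedral_eq_zero_of_orthogonal [NeZero n] (hn : Odd n) {f : DihedralGroup n → ℂ}
    (hf : ∀ g h, f (h * g * h⁻¹) = f g)
    (h1 : ∀ c hc, ∑ g, f g * (dihedralLinear n c hc g⁻¹).trace = 0)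
    (h2 : ∀ j ≠ 0, ∑ g, f g * (dihedralPlane n j g⁻¹).trace = 0) : f = 0 := by
  have hp := h1 1 (by norm_num)
  have hm := h1 (-1) (by norm_num)
  simp only [dihedral_sum_eq, inv_r, inv_sr, trace_dihedralLinear_r, trace_dihedralLinear_sr,
    ← Finset.sum_mul] at hp hm
  have hr : ∑ i, f (r i) = 0 := by linear_combination (hp + hm) / 2
  have hs : ∑ i, f (sr i) = 0 := by linear_combination (hp - hm) / 2
  have hneg : ∀ i, f (r (-i)) = f (r i) := fun i ↦ by
    rw [← hf (r i) (sr 0)]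
    simp
  have hsr : ∀ a, f (sr a) = f (sr 0) := fun a ↦ by
    obtain ⟨c, hc⟩ := isConj_iff.1 (dihedral_isConj_sr hn a)
    rw [← hc, hf]
  have hdft : ZMod.dft (fun i ↦ f (r i)) = 0 := by
    funext j
    rw [ZMod.dft_apply, Pi.zero_apply]
    rcases eq_or_ne j 0 with rfl | hj
    · simpa using hr
    · have h := h2 j hj
      have hsymm : ∑ i : ZMod n, f (r i) * ZMod.stdAddChar (i * j) =
          ∑ i : ZMod n, f (r i) * ZMod.stdAddChar (-(i * j)) := by
        rw [← Equiv.sum_comp (Equiv.neg (ZMod n))]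
        exact Finset.sum_congr rfl fun i _ ↦ by simp [hneg]
      simp only [dihedral_sum_eq, inv_r, inv_sr, trace_dihedralPlane_r, trace_dihedralPlane_sr,
        mul_zero, Finset.sum_const_zero, add_zero, neg_mul, neg_neg, mul_add,
        Finset.sum_add_distrib, hsymm] at h
      simp only [smul_eq_mul]
      rw [← add_self_eq_zero, ← h]
      simp only [mul_comm]
  have hr0 : (fun i ↦ f (r i)) = 0 := ZMod.dft.map_eq_zero_iff.1 hdft
  funext g
  rcases g with i | i
  · exact congrFun hr0 i
  · simpa [hsr, NeZero.ne n] using hs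

theorem irredCharsComplete_dihedral [NeZero n] (hn : Odd n) :
    IrredCharsComplete (DihedralGroup n) := fun _ hf h ↦
  dihedral_eq_zero_of_orthogonal hn hf (fun c hc ↦ h _ (isIrredChar_dihedralLinear c hc))
    fun _ hj ↦ h _ (isIrredChar_dihedralPlane hn hj)

theorem IsIrredChar.dihedral_cases [NeZero n] (hn : Odd n) {χ : DihedralGroup n → ℂ}
    (hχ : IsIrredChar χ) :
    (∃ c hc, χ = fun g ↦ (dihedralLinear n c hc g).trace) ∨
      ∃ j, χ = fun g ↦ (dihedralPlane n j g).trace := by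
  by_contra! hne
  have h0 : χ = 0 := dihedral_eq_zero_of_orthogonal hn hχ.conj_eq
    (fun c hc ↦ hχ.sum_mul_inv_eq_zero (isIrredChar_dihedralLinear c hc) (hne.1 c hc))
    fun j hj ↦ hχ.sum_mul_inv_eq_zero (isIrredChar_dihedralPlane hn hj) (hne.2 j)
  have h1 := hχ.sum_mul_inv_self
  simp only [h0, Pi.zero_apply, zero_mul, Finset.sum_const_zero] at h1
  exact NeZero.ne _ h1.symm

theorem finite_irredChars_dihedral [NeZero n] (hn : Odd n) :
    Finite {χ : DihedralGroup n → ℂ | IsIrredChar χ} := by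
  refine Set.Finite.subset (((Set.finite_range fun c : ({1, -1} : Set ℂ) ↦
    fun g : DihedralGroup n ↦ (dihedralLinear n c (by
      rcases c with ⟨c, rfl | rfl⟩ <;> norm_num) g).trace)).union
    (Set.finite_range fun j : ZMod n ↦ fun g ↦ (dihedralPlane n j g).trace)) fun χ hχ ↦ ?_
  rcases IsIrredChar.dihedral_cases hn hχ with ⟨c, hc, rfl⟩ | ⟨j, rfl⟩
  · exact Or.inl ⟨⟨c, mul_self_eq_one_iff.1 hc⟩, rfl⟩
  · exact Or.inr ⟨j, rfl⟩

theorem IsIrredChar.dihedral_r_ne_zero [NeZero n] (hn : Odd n) {χ : DihedralGroup n → ℂ}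
    (hχ : IsIrredChar χ) (i : ZMod n) : χ (r i) ≠ 0 := by
  rcases IsIrredChar.dihedral_cases hn hχ with ⟨c, hc, rfl⟩ | ⟨j, rfl⟩
  · simp
  · simp only [trace_dihedralPlane_r]
    intro h
    have e3 : (ZMod.stdAddChar (i * j) : ℂ) * ZMod.stdAddChar (-(i * j)) = 1 := by
      rw [← AddChar.map_add_eq_mul, add_neg_cancel, AddChar.map_zero_eq_one]
    have e4 : (ZMod.stdAddChar (2 • (i * j)) : ℂ) = -1 := by
      rw [AddChar.map_nsmul_eq_pow]
      linear_combination ZMod.stdAddChar (i * j) * h - e3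
    have e5 : (ZMod.stdAddChar (n • 2 • (i * j)) : ℂ) = (-1) ^ n := by
      rw [AddChar.map_nsmul_eq_pow, e4]
    rw [hn.neg_one_pow, nsmul_eq_mul, ZMod.natCast_self, zero_mul, AddChar.map_zero_eq_one] at e5
    norm_num at e5

theorem zIIG_dihedral_pos [NeZero n] (hn : Odd n) (h1 : n ≠ 1) : 0 < zIIG (DihedralGroup n) := by
  have := finite_irredChars_dihedral hn
  have : Nontrivial (ZMod n) := ZMod.nontrivial_iff.2 h1
  have hχ : IsIrredChar fun g ↦ (dihedralPlane n 1 g).trace :=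
    isIrredChar_dihedralPlane hn one_ne_zero
  let χ : {χ : DihedralGroup n → ℂ | IsIrredChar χ} := ⟨_, hχ⟩
  have : Nonempty ↥(nonzeroPairs (DihedralGroup n))ᶜ :=
    ⟨(χ, ConjClasses.mk (sr 0)), fun h ↦ mk_mem_nonzeroPairs.1 h (trace_dihedralPlane_sr 1 0)⟩
  have : Nonempty {χ : DihedralGroup n → ℂ | IsIrredChar χ} := ⟨χ⟩
  rw [zIIG, card_zeroPairs]
  have := Nat.card_pos (α := ↥(nonzeroPairs (DihedralGroup n))ᶜ)
  have := Nat.card_pos (α := {χ : DihedralGroup n → ℂ | IsIrredChar χ})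
  have := Nat.card_pos (α := ConjClasses (DihedralGroup n))
  positivity

theorem zIIG_dihedral_le [NeZero n] (hn : Odd n) :
    zIIG (DihedralGroup n) ≤ 1 / Nat.card (ConjClasses (DihedralGroup n)) := by
  have := finite_irredChars_dihedral hn
  have hle : Nat.card ↥(nonzeroPairs (DihedralGroup n))ᶜ ≤
      Nat.card {χ : DihedralGroup n → ℂ | IsIrredChar χ} := by
    have hcl : ∀ p ∈ (nonzeroPairs (DihedralGroup n))ᶜ, p.2 = ConjClasses.mk (sr 0) := by
      rintro ⟨χ, C⟩ hp
      induction C using Quotient.inductionOn with | h a => ?_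
      rcases a with i | i
      · exact (hp (mk_mem_nonzeroPairs.2 (IsIrredChar.dihedral_r_ne_zero hn χ.2 i))).elim
      · exact (ConjClasses.mk_eq_mk_iff_isConj.2 (dihedral_isConj_sr hn i)).symm
    refine Nat.card_le_card_of_injective (fun p ↦ p.1.1) fun p q h ↦ Subtype.ext (Prod.ext h ?_)
    rw [hcl _ p.2, hcl _ q.2]
  have : Nonempty {χ : DihedralGroup n → ℂ | IsIrredChar χ} :=
    ⟨⟨_, isIrredChar_dihedralLinear 1 (one_mul 1)⟩⟩
  have h1 := Nat.card_pos (α := {χ : DihedralGroup n → ℂ | IsIrredChar χ})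
  have h2 := Nat.card_pos (α := ConjClasses (DihedralGroup n))
  rw [zIIG, card_zeroPairs, div_le_div_iff₀ (by positivity) (by positivity), one_mul]
  gcongr

end Dihedral

theorem exists_pow_succ_near {x y ε : ℝ} (hx0 : 0 ≤ x) (hx1 : x ≤ 1) (hy0 : 0 < y) (hy1 : y < 1)
    (hε : 1 - y < ε) : ∃ n : ℕ, |y ^ (n + 1) - x| < ε := by
  rcases hx0.eq_or_lt with rfl | hx
  · obtain ⟨n, hn⟩ := exists_pow_lt_of_lt_one ((sub_pos.2 hy1).trans hε) hy1
    refine ⟨n, ?_⟩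
    rw [sub_zero, abs_of_pos (pow_pos hy0 _)]
    exact (pow_le_pow_of_le_one hy0.le hy1.le n.le_succ).trans_lt hn
  · obtain ⟨n, h1, h2⟩ := exists_nat_pow_near_of_lt_one hx hx1 hy0 hy1
    refine ⟨n, ?_⟩
    rw [abs_sub_lt_iff]
    have h3 : y ^ n ≤ 1 := pow_le_one₀ hy0.le hy1.le
    have h4 : y ^ n - y ^ (n + 1) ≤ 1 - y := by
      rw [pow_succ]
      nlinarith
    constructor <;> linarith

/-- Denseness of values of `zIIG` on finite groups. -/
theorem denseness_zII_group (L : ℝ) (hL1 : 0 ≤ L) (hL2 : L ≤ 1) (ε : ℝ) (hε : 0 < ε) :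
    ∃ (G : Type) (_ : Group G) (_ : Fintype G), |zIIG G - L| < ε := by
  obtain ⟨m, hm⟩ := exists_nat_one_div_lt (lt_min hε one_half_pos)
  have hn : Odd (2 * m + 3) := ⟨m + 1, by ring⟩
  have hcard : Nat.card (ConjClasses (DihedralGroup (2 * m + 3))) = m + 3 := by
    rw [DihedralGroup.card_conjClasses_odd hn]
    omega
  have hpos := zIIG_dihedral_pos hn (by omega)
  have hle := zIIG_dihedral_le hn
  have hfin := finite_irredChars_dihedral hn
  have hne : Nonempty {χ : DihedralGroup (2 * m + 3) → ℂ | IsIrredChar χ} :=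
    ⟨⟨_, isIrredChar_dihedralLinear 1 (one_mul 1)⟩⟩
  rw [zIIG_eq_one_sub, hcard] at hle
  rw [zIIG_eq_one_sub] at hpos
  have hlt : (1 : ℝ) / (m + 3 : ℕ) < min ε (1 / 2) := by
    refine lt_of_le_of_lt ?_ hm
    push_cast
    gcongr
    norm_num
  have h1 := hlt.trans_le (min_le_left _ _)
  have h2 := hlt.trans_le (min_le_right _ _)
  obtain ⟨k, hk⟩ := exists_pow_succ_near (sub_nonneg.2 hL2) (sub_le_self 1 hL1)
    (y := nonzeroRatio (DihedralGroup (2 * m + 3))) (ε := ε)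
    (by linarith) (by linarith) (by linarith)
  obtain ⟨K, _, _, -, _, _, hK⟩ :=
    exists_group_nonzeroRatio_eq_pow _ (irredCharsComplete_dihedral hn) k
  refine ⟨K, inferInstance, inferInstance, ?_⟩
  rw [zIIG_eq_one_sub, hK, ← abs_neg]
  convert hk using 2
  ring
end
end

section
/- For any real number L with 0 ≤ L ≤ 1 and any ε > 0, there exists a finite group G such that |u_I(G) − L| < ε. -/
open scoped Classical

noncomputable section

open scoped commutatorElement

/-- The underlying type of the Heisenberg group over `R`. -/
@[ext] structure Heisenberg (R : Type) where
  /-- upper left entry -/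
  a : R
  /-- lower right entry -/
  b : R
  /-- central entry -/
  c : R

namespace Heisenberg

variable {R : Type} [CommRing R]

instance : Mul (Heisenberg R) := ⟨fun x y ↦ ⟨x.a + y.a, x.b + y.b, x.c + y.c + x.a * y.b⟩⟩
instance : One (Heisenberg R) := ⟨⟨0, 0, 0⟩⟩
instance : Inv (Heisenberg R) := ⟨fun x ↦ ⟨-x.a, -x.b, -x.c + x.a * x.b⟩⟩

@[simp] theorem mul_a (x y : Heisenberg R) : (x * y).a = x.a + y.a := rfl
@[simp] theorem mul_b (x y : Heisenberg R) : (x * y).b = x.b + y.b := rfl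
@[simp] theorem mul_c (x y : Heisenberg R) : (x * y).c = x.c + y.c + x.a * y.b := rfl
@[simp] theorem one_a : (1 : Heisenberg R).a = 0 := rfl
@[simp] theorem one_b : (1 : Heisenberg R).b = 0 := rfl
@[simp] theorem one_c : (1 : Heisenberg R).c = 0 := rfl
@[simp] theorem inv_a (x : Heisenberg R) : x⁻¹.a = -x.a := rfl
@[simp] theorem inv_b (x : Heisenberg R) : x⁻¹.b = -x.b := rfl
@[simp] theorem inv_c (x : Heisenberg R) : x⁻¹.c = -x.c + x.a * x.b := rfl

instance : Group (Heisenberg R) :=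
  Group.ofLeftAxioms (by intros; ext <;> simp <;> ring) (by intros; ext <;> simp)
    (by intros; ext <;> simp)

/-- The entries of an element of the Heisenberg group. -/
def equivProd (R : Type) : Heisenberg R ≃ (R × R) × R where
  toFun x := ((x.a, x.b), x.c)
  invFun p := ⟨p.1.1, p.1.2, p.2⟩
  left_inv _ := rfl
  right_inv _ := rfl

instance (R : Type) [Finite R] : Finite (Heisenberg R) := .of_equiv _ (equivProd R).symm

theorem commutatorElement_eq (x y : Heisenberg R) : ⁅x, y⁆ = ⟨0, 0, x.a * y.b - y.a * x.b⟩ := by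
  rw [commutatorElement_def]
  ext <;> simp
  ring

theorem commute_commutatorElement (x y z : Heisenberg R) : Commute ⁅x, y⁆ z := by
  rw [commutatorElement_eq]
  ext <;> simp [add_comm]

theorem commute_iff (x y : Heisenberg R) : Commute x y ↔ x.a * y.b = y.a * x.b := by
  rw [← commutatorElement_eq_one_iff_commute, commutatorElement_eq, Heisenberg.ext_iff]
  simp [sub_eq_zero]

theorem card_commutator (R : Type) [CommRing R] :
    Nat.card (commutator (Heisenberg R)) = Nat.card R := by
  have h : ∀ x : Heisenberg R, x ∈ commutator (Heisenberg R) ↔ x.a = 0 ∧ x.b = 0 := by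
    intro x
    constructor
    · let f : Heisenberg R →* Multiplicative (R × R) :=
        { toFun := fun x ↦ .ofAdd (x.a, x.b), map_one' := rfl, map_mul' := fun _ _ ↦ rfl }
      intro hx
      have : f x = 1 := Abelianization.commutator_subset_ker f hx
      simpa [f, Prod.ext_iff] using congrArg Multiplicative.toAdd this
    · rintro ⟨ha, hb⟩
      have : x = ⁅(⟨x.c, 0, 0⟩ : Heisenberg R), ⟨0, 1, 0⟩⁆ := by
        rw [commutatorElement_eq]
        ext <;> simp [ha, hb]
      rw [this]
      exact Subgroup.commutator_mem_commutator (Subgroup.mem_top _) (Subgroup.mem_top _)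
  refine Nat.card_congr
    { toFun := fun x ↦ x.1.c
      invFun := fun c ↦ ⟨⟨0, 0, c⟩, (h _).2 ⟨rfl, rfl⟩⟩
      left_inv := fun x ↦ ?_
      right_inv := fun _ ↦ rfl }
  obtain ⟨ha, hb⟩ := (h _).1 x.2
  ext <;> simp [ha, hb]

theorem card_commute (F : Type) [Field F] [Fintype F] :
    (Nat.card {p : Heisenberg F × Heisenberg F // Commute p.1 p.2} : ℚ) =
      Nat.card F ^ 2 * (Nat.card F ^ 3 + Nat.card F ^ 2 - Nat.card F) := by
  have key : ∀ a b : F, (∑ p : F × F, if a * p.2 = p.1 * b then (1 : ℚ) else 0) =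
      if a = 0 then (if b = 0 then (Nat.card F : ℚ) ^ 2 else Nat.card F) else Nat.card F := by
    intro a b
    rw [Fintype.sum_prod_type]
    split_ifs with ha hb
    · simp [ha, hb, sq]
    · simp [ha, hb]
    · have : ∀ x y : F, a * y = x * b ↔ y = x * b / a := fun x y ↦ by
        rw [eq_div_iff ha, mul_comm]
      simp [this]
  let e : {p : Heisenberg F × Heisenberg F // Commute p.1 p.2} ≃
      {q : (F × F) × (F × F) // q.1.1 * q.2.2 = q.2.1 * q.1.2} × (F × F) :=
    { toFun := fun p ↦ (⟨((p.1.1.a, p.1.1.b), (p.1.2.a, p.1.2.b)), (commute_iff _ _).1 p.2⟩,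
        (p.1.1.c, p.1.2.c))
      invFun := fun q ↦ ⟨(⟨q.1.1.1.1, q.1.1.1.2, q.2.1⟩, ⟨q.1.1.2.1, q.1.1.2.2, q.2.2⟩),
        (commute_iff _ _).2 q.1.2⟩
      left_inv := fun _ ↦ rfl
      right_inv := fun _ ↦ rfl }
  rw [Nat.card_congr e, Nat.card_prod, Nat.card_prod, Nat.card_eq_fintype_card (α := {q // _}),
    Fintype.card_subtype, Nat.cast_mul, ← Finset.sum_boole, Fintype.sum_prod_type]
  simp_rw [key]
  rw [Fintype.sum_prod_type]
  have h2 : ∀ x y : ℚ, (∑ b : F, if b = 0 then x else y) = x + (Nat.card F - 1) * y := by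
    intro x y
    rw [← Finset.add_sum_erase _ _ (Finset.mem_univ (0 : F))]
    simp +contextual [Finset.sum_ite, Finset.filter_ne',
      Nat.cast_sub Fintype.card_pos]
  have h3 : ∀ a : F, (∑ b : F, if a = 0 then (if b = 0 then (Nat.card F : ℚ) ^ 2 else Nat.card F)
      else (Nat.card F : ℚ)) = if a = 0 then (Nat.card F : ℚ) ^ 2 + ((Nat.card F : ℚ) - 1) * Nat.card F
        else (Nat.card F : ℚ) ^ 2 := by
    intro a
    split_ifs
    · exact h2 _ _
    · simp [sq]
  simp_rw [h3, h2]
  push_cast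
  ring

theorem commProb_eq (F : Type) [Field F] [Fintype F] :
    commProb (Heisenberg F) =
      (Nat.card F ^ 2 + Nat.card F - 1) / Nat.card F ^ 3 := by
  have hq : (Nat.card F : ℚ) ≠ 0 := by simp
  rw [commProb_def, card_commute, Nat.card_congr (equivProd F), Nat.card_prod, Nat.card_prod]
  push_cast
  field_simp

end Heisenberg

section CharacterTheory

open CategoryTheory

variable {G : Type} [Group G]

/-- An endomorphism of a one-dimensional space is multiplication by its trace. -/
theorem eq_trace_smul_id_of_finrank_eq_one {V : Type} [AddCommGroup V] [Module ℂ V]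
    (h : Module.finrank ℂ V = 1) (f : V →ₗ[ℂ] V) :
    f = LinearMap.trace ℂ V f • LinearMap.id := by
  obtain ⟨c, rfl⟩ := (LinearEquiv.smul_id_of_finrank_eq_one h).surjective f
  rw [LinearEquiv.smul_id_of_finrank_eq_one_apply]
  have := Module.finite_of_finrank_eq_succ h
  rw [map_smul, LinearMap.trace_id, h]
  simp

/-- Schur's lemma: a linear endomorphism of a simple representation commuting with the action
is a scalar. -/
theorem FDRep.exists_eq_smul_id_of_forall_commute (V : FDRep ℂ G) [Simple V] (f : V →ₗ[ℂ] V)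
    (hf : ∀ g, f ∘ₗ V.ρ g = V.ρ g ∘ₗ f) : ∃ c : ℂ, f = c • LinearMap.id := by
  have h1 : Module.finrank ℂ (Representation.linHom V.ρ V.ρ).invariants = 1 := by
    rw [(Representation.linHom.invariantsEquivFDRepHom V V).finrank_eq]
    exact finrank_endomorphism_simple_eq_one ℂ V
  have hmem : ∀ f : V →ₗ[ℂ] V, (∀ g, f ∘ₗ V.ρ g = V.ρ g ∘ₗ f) →
      f ∈ (Representation.linHom V.ρ V.ρ).invariants := fun f hf g ↦ by
    rw [Representation.linHom_apply, ← LinearMap.comp_assoc, ← hf g, LinearMap.comp_assoc]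
    change f * (V.ρ g * V.ρ g⁻¹) = f
    rw [← map_mul]
    simp
  have hid := hmem LinearMap.id fun _ ↦ rfl
  obtain ⟨v, hv0, hv⟩ := finrank_eq_one_iff'.1 h1
  by_cases hid0 : (LinearMap.id : V →ₗ[ℂ] V) = 0
  · exact ⟨0, by rw [← LinearMap.comp_id f, hid0]; simp⟩
  · obtain ⟨c, hc⟩ := (finrank_eq_one_iff_of_nonzero' (⟨LinearMap.id, hid⟩ :
      (Representation.linHom V.ρ V.ρ).invariants) (by simpa using hid0)).1 h1 ⟨f, hmem f hf⟩
    exact ⟨c, (congrArg Subtype.val hc).symm⟩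

theorem FDRep.finrank_ne_zero_of_simple [Finite G] (V : FDRep ℂ G) [hV : Simple V] :
    Module.finrank ℂ V ≠ 0 := by
  have := Fintype.ofFinite G
  intro h
  have h0 : V.character = 0 := by
    have := Module.finrank_zero_iff.1 h
    ext g
    have : V.ρ g = 0 := Subsingleton.elim _ _
    simp [FDRep.character, this]
  have := V.simple_iff_char_is_norm_one.1 hV
  simp [h0, eq_comm, Fintype.card_ne_zero] at this

theorem Representation.IsIrreducible.isIrredChar [Finite G] {V : Type} [AddCommGroup V]
    [Module ℂ V] [FiniteDimensional ℂ V] (ρ : Representation ℂ G V) [hρ : ρ.IsIrreducible] :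
    IsIrredChar ρ.character := by
  have := Fintype.ofFinite G
  have : Invertible (Nat.card G : ℂ) := invertibleOfNonzero (by simp)
  refine ⟨FDRep.of ρ, (FDRep.simple_iff_char_is_norm_one _).2 ?_, rfl⟩
  have h := Representation.char_orthonormal ρ ρ
  rw [if_pos ⟨Representation.Equiv.refl ρ⟩, inv_mul_eq_one₀ (by simp)] at h
  exact h.symm

theorem IsIrredChar.apply_eq_of_isConj {χ : G → ℂ} (hχ : IsIrredChar χ) {g h : G}
    (hgh : IsConj g h) : χ g = χ h := by
  obtain ⟨V, -, rfl⟩ := hχ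
  obtain ⟨c, rfl⟩ := isConj_iff.1 hgh
  exact (V.char_conj g c).symm

theorem IsIrredChar.sum_mul_inv [Fintype G] {χ ψ : G → ℂ} (hχ : IsIrredChar χ)
    (hψ : IsIrredChar ψ) : ∑ g, χ g * ψ g⁻¹ = if χ = ψ then (Nat.card G : ℂ) else 0 := by
  have hG : (Nat.card G : ℂ) ≠ 0 := by simp
  have : Invertible (Nat.card G : ℂ) := invertibleOfNonzero hG
  obtain ⟨V, hV, rfl⟩ := hχ
  obtain ⟨W, hW, rfl⟩ := hψ
  split_ifs with h
  · rw [← h]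
    exact V.simple_iff_char_is_norm_one.1 hV
  · have h1 := FDRep.char_orthonormal V W
    rw [if_neg fun ⟨i⟩ ↦ h (FDRep.char_iso i)] at h1
    simpa using h1

/-- An irreducible character, as a function on conjugacy classes. -/
def IsIrredChar.onConjClasses {χ : G → ℂ} (hχ : IsIrredChar χ) (C : ConjClasses G) : ℂ :=
  Quotient.lift χ (fun _ _ h ↦ hχ.apply_eq_of_isConj h) C

theorem linearIndependent_onConjClasses [Finite G] :
    LinearIndependent ℂ fun χ : {χ : G → ℂ | IsIrredChar χ} ↦ χ.2.onConjClasses := by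
  have := Fintype.ofFinite G
  rw [linearIndependent_iff']
  intro s c hc ψ hψ
  have h : ∀ g : G, ∑ χ ∈ s, c χ * χ.1 g = 0 := fun g ↦ by
    have := congrFun hc (ConjClasses.mk g)
    rw [Finset.sum_apply] at this
    exact this
  have h2 : ∑ g : G, (∑ χ ∈ s, c χ * χ.1 g) * ψ.1 g⁻¹ = 0 := by simp [h]
  simp_rw [Finset.sum_mul] at h2
  rw [Finset.sum_comm] at h2
  simp_rw [mul_assoc, ← Finset.mul_sum, fun χ : {χ : G → ℂ | IsIrredChar χ} ↦
    IsIrredChar.sum_mul_inv χ.2 ψ.2, ← Subtype.ext_iff] at h2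
  simpa [hψ] using h2

theorem finite_isIrredChar [Finite G] : Finite {χ : G → ℂ | IsIrredChar χ} :=
  have := Fintype.ofFinite (ConjClasses G)
  linearIndependent_onConjClasses.finite

/-- A class function acts by zero on an irreducible representation whose character is orthogonal
to it. -/
theorem Representation.IsIrreducible.sum_smul_eq_zero [Fintype G] {V : Type} [AddCommGroup V]
    [Module ℂ V] [FiniteDimensional ℂ V] (ρ : Representation ℂ G V) [hρ : ρ.IsIrreducible]
    (f : G → ℂ) (hf : ∀ g h, f (h * g * h⁻¹) = f g) (h0 : ∑ g, f g * ρ.character g = 0) :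
    ∑ g, f g • ρ g = 0 := by
  have hV : Module.finrank ℂ V ≠ 0 := by
    have : Nontrivial V := IsSimpleModule.nontrivial (MonoidAlgebra ℂ G) ρ.asModule
    exact Module.finrank_pos.ne'
  have hcomm : ∀ x, (∑ g, f g • ρ g) * ρ x = ρ x * ∑ g, f g • ρ g := by
    intro x
    rw [Finset.sum_mul, Finset.mul_sum]
    refine Fintype.sum_equiv (MulAut.conj x⁻¹).toEquiv _ _ fun g ↦ ?_
    simp only [MulEquiv.toEquiv_eq_coe, EquivLike.coe_coe, MulAut.conj_apply, hf, smul_mul_assoc,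
      mul_smul_comm, ← map_mul]
    simp [mul_assoc]
  obtain ⟨c, hc⟩ := (Representation.IsIrreducible.algebraMap_intertwiningMap_bijective_of_isAlgClosed
    (ρ := ρ)).surjective ⟨∑ g, f g • ρ g, hcomm⟩
  have hc' : ∑ g, f g • ρ g = c • LinearMap.id := by
    have := congrArg Representation.IntertwiningMap.toLinearMap hc
    exact this.symm
  have := congrArg (LinearMap.trace ℂ V) hc'
  simp only [map_sum, map_smul, LinearMap.trace_id, smul_eq_mul] at this
  rw [show ∑ g, f g * LinearMap.trace ℂ V (ρ g) = 0 from h0] at this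
  have hc0 : c = 0 := by simpa [hV] using this.symm
  rw [hc', hc0, zero_smul]

/-- A class function orthogonal to all irreducible characters annihilates every simple module. -/
theorem sum_single_smul_eq_zero [Fintype G] (f : G → ℂ) (hf : ∀ g h, f (h * g * h⁻¹) = f g)
    (h0 : ∀ χ, IsIrredChar χ → ∑ g, f g * χ g = 0) (M : Type) [AddCommGroup M] [Module ℂ M]
    [Module (MonoidAlgebra ℂ G) M] [IsScalarTower ℂ (MonoidAlgebra ℂ G) M]
    [IsSimpleModule (MonoidAlgebra ℂ G) M] (m : M) :
    (∑ g, MonoidAlgebra.single g (f g) : MonoidAlgebra ℂ G) • m = 0 := by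
  have : Module.Finite ℂ M := Module.Finite.trans (MonoidAlgebra ℂ G) M
  let ρ : Representation ℂ G M := Representation.ofModule' M
  have hlift : ρ.asAlgebraHom = Algebra.lsmul ℂ ℂ M :=
    (MonoidAlgebra.lift ℂ (M →ₗ[ℂ] M) G).apply_symm_apply _
  let e : ρ.asModule ≃ₗ[MonoidAlgebra ℂ G] M :=
    { ρ.asModuleEquiv.toAddEquiv with
      map_smul' := fun r x ↦ by
        change ρ.asModuleEquiv (r • x) = r • ρ.asModuleEquiv x
        rw [Representation.asModuleEquiv_map_smul, hlift]
        rfl }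
  have hρ : ρ.IsIrreducible :=
    (Representation.irreducible_iff_isSimpleModule_asModule _).2 (IsSimpleModule.congr e)
  have h := Representation.IsIrreducible.sum_smul_eq_zero ρ f hf (h0 _ hρ.isIrredChar)
  rw [Finset.sum_smul]
  have h' := LinearMap.congr_fun h m
  rw [LinearMap.sum_apply] at h'
  refine (Finset.sum_congr rfl fun g _ ↦ ?_).trans h'
  rw [← ρ.asAlgebraHom_single, hlift]
  rfl

/-- A class function orthogonal to all irreducible characters vanishes. -/
theorem eq_zero_of_forall_isIrredChar [Fintype G] (f : G → ℂ)
    (hf : ∀ g h, f (h * g * h⁻¹) = f g) (h0 : ∀ χ, IsIrredChar χ → ∑ g, f g * χ g = 0) : f = 0 := by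
  let z : MonoidAlgebra ℂ G := ∑ g, MonoidAlgebra.single g (f g)
  have hz : z = 0 := by
    have h1 : (1 : MonoidAlgebra ℂ G) ∈
        sSup {S : Submodule (MonoidAlgebra ℂ G) (MonoidAlgebra ℂ G) |
          IsSimpleModule (MonoidAlgebra ℂ G) S} := by
      rw [IsSemisimpleModule.sSup_simples_eq_top]
      trivial
    rw [← mul_one z]
    rw [sSup_eq_iSup'] at h1
    refine Submodule.iSup_induction _ (motive := fun x ↦ z * x = 0) h1 ?_ (mul_zero z) ?_
    · intro S x hx
      have : IsSimpleModule (MonoidAlgebra ℂ G) S.1 := S.2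
      exact congrArg Subtype.val (sum_single_smul_eq_zero f hf h0 S.1 ⟨x, hx⟩)
    · intro x y hx hy
      rw [mul_add, hx, hy, add_zero]
  ext g
  have := congrArg (fun w : MonoidAlgebra ℂ G ↦ w.coeff g) hz
  simpa [z, Finsupp.single_apply] using this

/-- There are as many irreducible characters as conjugacy classes. -/
theorem card_isIrredChar (G : Type) [Group G] [Finite G] :
    Nat.card {χ : G → ℂ | IsIrredChar χ} = Nat.card (ConjClasses G) := by
  have := Fintype.ofFinite G
  have := finite_isIrredChar (G := G)
  have := Fintype.ofFinite (ConjClasses G)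
  have := Fintype.ofFinite {χ : G → ℂ | IsIrredChar χ}
  rw [Nat.card_eq_fintype_card, Nat.card_eq_fintype_card]
  apply le_antisymm
  · simpa using (linearIndependent_onConjClasses (G := G)).fintype_card_le_finrank
  · let Φ : (ConjClasses G → ℂ) →ₗ[ℂ] ({χ : G → ℂ | IsIrredChar χ} → ℂ) :=
      { toFun := fun f χ ↦ ∑ g, f (ConjClasses.mk g) * χ.1 g
        map_add' := fun _ _ ↦ by ext; simp [add_mul, Finset.sum_add_distrib]
        map_smul' := fun _ _ ↦ by ext; simp [mul_assoc, Finset.mul_sum] }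
    have hΦ : Function.Injective Φ := by
      rw [injective_iff_map_eq_zero]
      intro f hf
      have h := eq_zero_of_forall_isIrredChar (fun g ↦ f (ConjClasses.mk g))
        (fun g h ↦ congrArg f (ConjClasses.mk_eq_mk_iff_isConj.2 (isConj_iff.2 ⟨h, rfl⟩)).symm)
        fun χ hχ ↦ congrFun hf ⟨χ, hχ⟩
      ext C
      obtain ⟨g, rfl⟩ := C.exists_rep
      exact congrFun h g
    simpa using LinearMap.finrank_le_finrank_of_injective hΦ

theorem FDRep.ρ_eq_character_smul_id {V : FDRep ℂ G} (h : V.character 1 = 1) (g : G) :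
    V.ρ g = V.character g • LinearMap.id :=
  eq_trace_smul_id_of_finrank_eq_one (by exact_mod_cast V.char_one.symm.trans h) (V.ρ g)

theorem IsIrredChar.map_mul_of_apply_one {χ : G → ℂ} (hχ : IsIrredChar χ) (h : χ 1 = 1) (x y : G) :
    χ (x * y) = χ x * χ y := by
  obtain ⟨V, -, rfl⟩ := hχ
  have hy : V.ρ (x * y) = V.character y • V.ρ x := by
    rw [map_mul, FDRep.ρ_eq_character_smul_id h y]
    ext v
    simp
  change LinearMap.trace ℂ V (V.ρ (x * y)) = _
  rw [hy, map_smul, smul_eq_mul, mul_comm]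
  rfl

theorem IsIrredChar.isRootOfUnity_of_apply_one [Finite G] {χ : G → ℂ} (hχ : IsIrredChar χ)
    (h : χ 1 = 1) (g : G) : IsRootOfUnity (χ g) := by
  let φ : G →* ℂ := { toFun := χ, map_one' := h, map_mul' := hχ.map_mul_of_apply_one h }
  refine ⟨Nat.card G, Nat.card_pos, ?_⟩
  change φ g ^ Nat.card G = 1
  rw [← map_pow, pow_card_eq_one', map_one]

/-- In a group of nilpotency class at most two, only linear characters take roots of unity as
values. -/
theorem IsIrredChar.apply_one_of_isRootOfUnity [Finite G]
    (hG : ∀ x y z : G, Commute ⁅x, y⁆ z) {χ : G → ℂ} (hχ : IsIrredChar χ) {g : G}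
    (hg : IsRootOfUnity (χ g)) : χ 1 = 1 := by
  obtain ⟨V, hV, rfl⟩ := hχ
  obtain ⟨n, hn, hgn⟩ := hg
  have hg0 : V.character g ≠ 0 := by
    intro h
    simp [h, hn.ne'] at hgn
  have hd := V.finrank_ne_zero_of_simple
  have hcomm : ∀ x, V.ρ (x * g * x⁻¹) = V.ρ g := by
    intro x
    obtain ⟨c, hc⟩ := V.exists_eq_smul_id_of_forall_commute (V.ρ ⁅x, g⁆) fun y ↦ by
      change V.ρ ⁅x, g⁆ * V.ρ y = V.ρ y * V.ρ ⁅x, g⁆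
      rw [← map_mul, (hG x g y).eq, map_mul]
    have hx : V.ρ (x * g * x⁻¹) = c • V.ρ g := by
      rw [show x * g * x⁻¹ = ⁅x, g⁆ * g by simp [commutatorElement_def], map_mul, hc]
      ext v
      simp
    have h1 : V.character g = c * V.character g := by
      rw [← V.char_conj g x]
      change LinearMap.trace ℂ V (V.ρ (x * g * x⁻¹)) = _
      rw [hx, map_smul, V.char_conj]
      rfl
    rw [hx, (mul_eq_right₀ hg0).1 h1.symm, one_smul]
  obtain ⟨c, hc⟩ := V.exists_eq_smul_id_of_forall_commute (V.ρ g) fun x ↦ by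
    change V.ρ g * V.ρ x = V.ρ x * V.ρ g
    rw [← hcomm x, ← map_mul, ← map_mul]
    simp [hcomm x]
  have hg1 : V.character g = c * Module.finrank ℂ V := by
    change LinearMap.trace ℂ V (V.ρ g) = _
    rw [hc, map_smul, LinearMap.trace_id, smul_eq_mul]
  have hpow : ∀ m : ℕ, V.ρ (g ^ m) = c ^ m • LinearMap.id := by
    intro m
    induction m with
    | zero => simp; rfl
    | succ m ih =>
      rw [pow_succ, map_mul, ih, hc, pow_succ']
      ext v
      simp [mul_smul, smul_comm c]
  have hcn : c ^ Nat.card G = 1 := by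
    have h := congrArg (LinearMap.trace ℂ V) (hpow (Nat.card G))
    rw [pow_card_eq_one', map_one, LinearMap.trace_one, map_smul, LinearMap.trace_id, smul_eq_mul,
      right_eq_mul₀ (by exact_mod_cast hd)] at h
    exact h
  have hcnorm : ‖c‖ = 1 := Complex.norm_eq_one_of_pow_eq_one hcn Nat.card_pos.ne'
  have hnorm := Complex.norm_eq_one_of_pow_eq_one hgn hn.ne'
  rw [hg1, norm_mul, hcnorm, one_mul, Complex.norm_natCast] at hnorm
  rw [V.char_one]
  exact_mod_cast hnorm

theorem card_isIrredChar_apply_one (G : Type) [Group G] [Finite G] :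
    Nat.card {χ : G → ℂ | IsIrredChar χ ∧ χ 1 = 1} = Nat.card (Abelianization G) := by
  have : Nat.card (G →* ℂˣ) = Nat.card (Abelianization G) := by
    rw [Nat.card_congr (Abelianization.lift (G := G) (A := ℂˣ)),
      CommGroup.card_monoidHom_of_hasEnoughRootsOfUnity]
  rw [← this]
  let F : (G →* ℂˣ) → (G → ℂ) := fun φ g ↦ φ g
  have hF : Function.Injective F := fun φ ψ h ↦ by
    ext g
    exact congrFun h g
  have hrange : Set.range F = {χ : G → ℂ | IsIrredChar χ ∧ χ 1 = 1} := by
    ext χ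
    constructor
    · rintro ⟨φ, rfl⟩
      refine ⟨?_, by simp [F]⟩
      let ρ : Representation ℂ G ℂ :=
        ((Algebra.lmul ℂ ℂ : ℂ →* Module.End ℂ ℂ).comp (Units.coeHom ℂ)).comp φ
      have hρ : FDRep.character (FDRep.of ρ) = F φ := by
        ext g
        exact Algebra.trace_self_apply (φ g : ℂ)
      have := Fintype.ofFinite G
      refine ⟨FDRep.of ρ, (FDRep.simple_iff_char_is_norm_one _).2 ?_, hρ.symm⟩
      simp [hρ, F]
    · rintro ⟨hχ, h1⟩
      let ψ : G →* ℂ := { toFun := χ, map_one' := h1, map_mul' := hχ.map_mul_of_apply_one h1 }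
      exact ⟨ψ.toHomUnits, rfl⟩
  rw [← hrange, Nat.card_congr (Equiv.ofInjective F hF).symm]

/-- For a group of nilpotency class at most two, `uIG` is the proportion of linear characters among
the irreducible ones. -/
theorem uIG_eq (G : Type) [Group G] [Finite G] (hG : ∀ x y z : G, Commute ⁅x, y⁆ z) :
    uIG G = ((commProb G : ℚ) * Nat.card (commutator G) : ℝ)⁻¹ := by
  have hset : {p : (G → ℂ) × G | IsIrredChar p.1 ∧ IsRootOfUnity (p.1 p.2)} =
      {χ : G → ℂ | IsIrredChar χ ∧ χ 1 = 1} ×ˢ Set.univ := by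
    ext ⟨χ, g⟩
    simp only [Set.mem_ofPred_eq, Set.mem_prod, Set.mem_univ, and_true]
    exact ⟨fun h ↦ ⟨h.1, h.1.apply_one_of_isRootOfUnity hG h.2⟩,
      fun h ↦ ⟨h.1, h.1.isRootOfUnity_of_apply_one h.2 g⟩⟩
  rw [uIG, hset, Nat.card_congr (Equiv.Set.prod _ _), Nat.card_prod, card_isIrredChar_apply_one,
    card_isIrredChar, commProb_def', Nat.card_congr (Equiv.Set.univ G)]
  have h := (commutator G).card_eq_card_quotient_mul_card_subgroup
  have h1 : (Nat.card (commutator G) : ℝ) ≠ 0 := Nat.cast_ne_zero.2 Nat.card_pos.ne'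
  have h2 : (Nat.card G : ℝ) ≠ 0 := Nat.cast_ne_zero.2 Nat.card_pos.ne'
  have h3 : (Nat.card (ConjClasses G) : ℝ) ≠ 0 := Nat.cast_ne_zero.2 Nat.card_pos.ne'
  have h' : (Nat.card G : ℝ) = Nat.card (Abelianization G) * Nat.card (commutator G) := by
    exact_mod_cast h
  push_cast
  field_simp
  rw [h']

end CharacterTheory

theorem commProb_mul_card_commutator_pi (k : ℕ) (H : Type) [Group H] [Finite H] :
    commProb (Fin k → H) * Nat.card (commutator (Fin k → H)) =
      (commProb H * Nat.card (commutator H)) ^ k := by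
  have h : commutator (Fin k → H) = Subgroup.pi Set.univ fun _ ↦ commutator H := by
    simp only [commutator_def]
    rw [← Subgroup.commutator_pi_pi_of_finite, Subgroup.pi_top]
  have e : (Subgroup.pi Set.univ fun _ : Fin k ↦ commutator H) ≃ (Fin k → commutator H) :=
    { toFun := fun x i ↦ ⟨x.1 i, x.2 i trivial⟩
      invFun := fun x ↦ ⟨fun i ↦ x i, fun i _ ↦ (x i).2⟩
      left_inv := fun _ ↦ rfl
      right_inv := fun _ ↦ rfl }
  rw [h, Nat.card_congr e, Nat.card_fun, commProb_function]
  simp [mul_pow]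

theorem uIG_heisenberg_pow (p k : ℕ) [Fact p.Prime] :
    uIG (Fin k → Heisenberg (ZMod p)) = ((p : ℝ) ^ 2 / (p ^ 2 + p - 1)) ^ k := by
  rw [uIG_eq _ fun x y z ↦ show _ = _ from
    funext fun i ↦ (Heisenberg.commute_commutatorElement (x i) (y i) (z i)).eq]
  have h := commProb_mul_card_commutator_pi k (Heisenberg (ZMod p))
  rw [Heisenberg.commProb_eq, Heisenberg.card_commutator, Nat.card_zmod] at h
  have h' : ((commProb (Fin k → Heisenberg (ZMod p)) : ℚ) *
      Nat.card (commutator (Fin k → Heisenberg (ZMod p))) : ℝ) =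
      ((p ^ 2 + p - 1) / p ^ 3 * p) ^ k := by exact_mod_cast h
  have hp : (p : ℝ) ≠ 0 := by exact_mod_cast (Fact.out : p.Prime).ne_zero
  rw [h', ← inv_pow]
  congr 1
  rw [show ((p : ℝ) ^ 2 + p - 1) / p ^ 3 * p = (p ^ 2 + p - 1) / p ^ 2 by field_simp, inv_div]

/-- Powers of a number just below one come close to every point of the unit interval. -/
theorem exists_abs_pow_sub_lt {r L ε : ℝ} (hr0 : 0 < r) (hr1 : r < 1) (hrε : 1 - r < ε)
    (hL0 : 0 ≤ L) (hL1 : L ≤ 1) : ∃ k : ℕ, |r ^ k - L| < ε := by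
  rcases hL0.eq_or_lt with rfl | hL0
  · obtain ⟨k, hk⟩ := exists_pow_lt_of_lt_one ((sub_pos.2 hr1).trans hrε) hr1
    exact ⟨k, by rwa [sub_zero, abs_of_pos (pow_pos hr0 k)]⟩
  · obtain ⟨k, hk1, hk2⟩ := exists_nat_pow_near_of_lt_one hL0 hL1 hr0 hr1
    refine ⟨k, ?_⟩
    have h1 : r ^ k ≤ 1 := pow_le_one₀ hr0.le hr1.le
    rw [abs_of_nonneg (by linarith)]
    rw [pow_succ] at hk1
    nlinarith

/-- Denseness of values of `uIG` on finite groups. -/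
theorem denseness_uI_group (L : ℝ) (hL1 : 0 ≤ L) (hL2 : L ≤ 1) (ε : ℝ) (hε : 0 < ε) :
    ∃ (G : Type) (_ : Group G) (_ : Fintype G), |uIG G - L| < ε := by
  obtain ⟨N, hN⟩ := exists_nat_one_div_lt hε
  obtain ⟨p, hpN, hp⟩ := Nat.exists_infinite_primes (N + 1)
  have : Fact p.Prime := ⟨hp⟩
  have hp1 : (1 : ℝ) < p := by exact_mod_cast hp.one_lt
  have hp2 : (0 : ℝ) < (p : ℝ) ^ 2 + p - 1 := by nlinarith
  have hclose : 1 - (p : ℝ) ^ 2 / (p ^ 2 + p - 1) < ε := by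
    refine lt_of_le_of_lt ?_ hN
    have hNp : (N : ℝ) + 1 ≤ p := by exact_mod_cast hpN
    refine le_trans ?_ (one_div_le_one_div_of_le (by positivity) hNp)
    rw [one_sub_div hp2.ne', div_le_div_iff₀ hp2 (by linarith)]
    nlinarith
  obtain ⟨k, hk⟩ := exists_abs_pow_sub_lt (by positivity) ((div_lt_one hp2).2 (by linarith))
    hclose hL1 hL2
  exact ⟨Fin k → Heisenberg (ZMod p), inferInstance, Fintype.ofFinite _,
    by rwa [uIG_heisenberg_pow]⟩
end
end
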